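/- arXiv:1811.05793 — 2 statements merged into one kernel-verified Lean document; each statement's English description precedes it below -/
import Mathlib

section
/- For all non-negative integers r₀, r₁, not both zero, and each real R > 0, the following holds. Let V₀ and V₁ be disjoint finite sets and let ℋ be a non-empty (r₀, r₁)-bounded hypergraph on (V₀, V₁), and let b, m, q be positive integers with b ≤ min{m, |V₁|}, satisfying Δ_{(ℓ₀,ℓ₁)}(ℋ) ≤ R · (b^{ℓ₀+ℓ₁−1}/(m^{ℓ₀}·|V₁|^{ℓ₁})) · e(ℋ) · (m/q)^{[ℓ₀>0]} for every pair (ℓ₀, ℓ₁) ∈ {0, 1, …, r₀} × {0, 1, …, r₁} ∖ {(0,0)}, where [ℓ₀>0] equals 1 if ℓ₀ > 0 and 0 otherwise. Then, setting δ := 2^{−(r₀+r₁+1)(r₀+r₁)}·R^{−1}, there exist a family 𝒮 of pairs (S₀, S₁) with S₀ ⊆ V₀, |S₀| ≤ r₀·b, S₁ ⊆ V₁, |S₁| ≤ r₁·b, and functions f : 𝒮 → 2^{V₀} × 2^{V₁} and g : 𝓕_{≤m}(ℋ) → 𝒮, such that: (i) if f(g(I, J)) = (A, B) with A ⊆ V₀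 and B ⊆ V₁, then A ⊆ I and J ⊆ B; (ii) for every (A, B) in the image of f, either |A| ≥ δ·q or |B| ≤ (1−δ)·|V₁|; (iii) if g(I, J) = (S₀, S₁) and f(g(I, J)) = (A, B), then S₀ ⊆ V₀ ∖ I and S₁ ⊆ J, and |S₀| > 0 only if |A| ≥ δ·q. -/
/-- A decision tree whose internal nodes ask whether a vertex belongs to an unknown set. -/
inductive QueryTree (α β : Type*) where
  | leaf : β → QueryTree α β
  | node : α → QueryTree α β → QueryTree α β → QueryTree α β

namespace QueryTree

variable {α β γ : Type*} [DecidableEq α]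

/-- The vertices queried with a positive answer when the tree is run on `W`. -/
def fingerprint : QueryTree α β → Finset α → Finset α
  | leaf _, _ => ∅
  | node v y n, W => if v ∈ W then insert v (y.fingerprint W) else n.fingerprint W

/-- The vertices queried with a negative answer when the tree is run on `W`. -/
def excluded : QueryTree α β → Finset α → Finset α
  | leaf _, _ => ∅
  | node v y n, W => if v ∈ W then y.excluded W else insert v (n.excluded W)

/-- The label of the leaf reached when the tree is run on `W`. -/
def output : QueryTree α β → Finset α → β
  | leaf x, _ => x
  | node v y n, W => if v ∈ W then y.output W else n.output W

/-- Sequential composition of query trees. -/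
def bind : QueryTree α β → (β → QueryTree α γ) → QueryTree α γ
  | leaf x, k => k x
  | node v y n, k => node v (y.bind k) (n.bind k)

theorem fingerprint_subset (t : QueryTree α β) (W : Finset α) : t.fingerprint W ⊆ W := by
  induction t with
  | leaf x => simp [fingerprint]
  | node v y n hy hn =>
    by_cases h : v ∈ W
    · simpa [fingerprint, h] using Finset.insert_subset h hy
    · simpa [fingerprint, h] using hn

theorem disjoint_excluded (t : QueryTree α β) (W : Finset α) : Disjoint (t.excluded W) W := by
  induction t with
  | leaf x => simp [excluded]
  | node v y n hy hn =>
    by_cases h : v ∈ W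
    · simpa [excluded, h] using hy
    · simpa [excluded, h] using hn

theorem excluded_eq_of_subset (t : QueryTree α β) {W W' : Finset α}
    (h : t.fingerprint W ⊆ W') (h' : W' ⊆ W) : t.excluded W' = t.excluded W := by
  induction t with
  | leaf x => rfl
  | node v y n hy hn =>
    by_cases hv : v ∈ W
    · simp only [fingerprint, hv, if_true, Finset.insert_subset_iff] at h
      simp [excluded, hv, h.1, hy h.2]
    · simp only [fingerprint, hv, if_false] at h
      have hv' : v ∉ W' := fun hw => hv (h' hw)
      simp [excluded, hv, hv', hn h]

theorem excluded_fingerprint (t : QueryTree α β) (W : Finset α) :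
    t.excluded (t.fingerprint W) = t.excluded W :=
  t.excluded_eq_of_subset subset_rfl (t.fingerprint_subset W)

theorem fingerprint_bind (t : QueryTree α β) (k : β → QueryTree α γ) (W : Finset α) :
    (t.bind k).fingerprint W = t.fingerprint W ∪ (k (t.output W)).fingerprint W := by
  induction t with
  | leaf x => simp [bind, fingerprint, output]
  | node v y n hy hn => by_cases h : v ∈ W <;> simp [bind, fingerprint, output, h, hy, hn]

theorem excluded_bind (t : QueryTree α β) (k : β → QueryTree α γ) (W : Finset α) :
    (t.bind k).excluded W = t.excluded W ∪ (k (t.output W)).excluded W := by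
  induction t with
  | leaf x => simp [bind, excluded, output]
  | node v y n hy hn => by_cases h : v ∈ W <;> simp [bind, excluded, output, h, hy, hn]

theorem exists_forall_excluded_eq (Q : Finset α) : ∃ t : QueryTree α Unit,
    ∀ W, Disjoint Q W → t.fingerprint W = ∅ ∧ t.excluded W = Q := by
  induction Q using Finset.induction_on with
  | empty => exact ⟨leaf (), fun W _ => ⟨rfl, rfl⟩⟩
  | insert v Q _ ih =>
    obtain ⟨t, ht⟩ := ih
    refine ⟨node v (leaf ()) t, fun W hW => ?_⟩
    rw [Finset.disjoint_insert_left] at hW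
    simp [fingerprint, excluded, hW.1, ht W hW.2]

end QueryTree

/-- The number of `i ∈ E` whose edge `p i` contains `L`. -/
def edgeDegree {ι α : Type*} [DecidableEq α] (E : Finset ι) (p : ι → Finset α)
    (L : Finset α) : ℕ :=
  (E.filter fun i => L ⊆ p i).card

/-- The family `(G, p')` consists of edges of `(E, p)` from each of which one vertex of `U` has been
removed, and its degrees are bounded by `D`. -/
structure IsPartialLink {ι α : Type*} [DecidableEq α] (E : Finset ι) (p : ι → Finset α)
    (U : Finset α) (D : Finset α → ℝ) (G : Finset ι) (p' : ι → Finset α) : Prop where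
  subset : G ⊆ E
  eq_erase : ∀ i ∈ G, ∃ v ∈ U, v ∈ p i ∧ p' i = (p i).erase v
  degree_le : ∀ L : Finset α, L.Nonempty → (edgeDegree G p' L : ℝ) ≤ D L

/-- The edges of `(E, p)` that are not used in `G`, avoid `X`, and contain no set whose degree in
`(G, p')` has reached `T`. -/
noncomputable def availableEdges {ι α : Type*} [DecidableEq α] (E : Finset ι) (p : ι → Finset α)
    (T : Finset α → ℝ) (G : Finset ι) (p' : ι → Finset α) (X : Finset α) : Finset ι :=
  open Classical in
  E.filter fun i => i ∉ G ∧ Disjoint (p i) X ∧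
    ∀ L ⊆ p i, L.Nonempty → (edgeDegree G p' L : ℝ) < T L

section Stage

variable {ι α : Type*} [DecidableEq α]

theorem mem_availableEdges {E : Finset ι} {p : ι → Finset α} {T : Finset α → ℝ} {G : Finset ι}
    {p' : ι → Finset α} {X : Finset α} {i : ι} :
    i ∈ availableEdges E p T G p' X ↔ i ∈ E ∧ i ∉ G ∧ Disjoint (p i) X ∧
      ∀ L ⊆ p i, L.Nonempty → (edgeDegree G p' L : ℝ) < T L := by
  simp [availableEdges]

theorem exists_card_le_mul_edgeDegree {A : Finset ι} {p : ι → Finset α} {T : Finset α} {M : ℝ}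
    (hA : A.Nonempty) (hT : (T.card : ℝ) ≤ M) (h : ∀ i ∈ A, ∃ v ∈ T, v ∈ p i) :
    ∃ v ∈ T, (A.card : ℝ) ≤ M * edgeDegree A p {v} := by
  classical
  by_contra! hlt
  obtain ⟨i, hi⟩ := hA
  obtain ⟨v, hv, -⟩ := h i hi
  have hM : 0 < M := lt_of_lt_of_le (by exact_mod_cast Finset.card_pos.2 ⟨v, hv⟩) hT
  have h1 : (A.card : ℝ) ≤ ∑ v ∈ T, (edgeDegree A p {v} : ℝ) := by
    have : A ⊆ T.biUnion fun v => A.filter fun i => {v} ⊆ p i := by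
      intro i hi
      obtain ⟨v, hv, hvi⟩ := h i hi
      simp only [Finset.mem_biUnion, Finset.mem_filter, Finset.singleton_subset_iff]
      exact ⟨v, hv, hi, hvi⟩
    exact_mod_cast (Finset.card_le_card this).trans Finset.card_biUnion_le
  have h2 : ∑ v ∈ T, (edgeDegree A p {v} : ℝ) < ∑ _v ∈ T, (A.card : ℝ) / M :=
    Finset.sum_lt_sum_of_nonempty ⟨v, hv⟩ fun v hv => by
      rw [lt_div_iff₀ hM, mul_comm]; exact hlt v hv
  rw [Finset.sum_const, nsmul_eq_mul] at h2
  have h3 : (T.card : ℝ) * (A.card / M) ≤ M * (A.card / M) := by gcongr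
  rw [mul_div_cancel₀ _ hM.ne'] at h3
  linarith

theorem sum_edgeDegree_le {G : Finset ι} {p' : ι → Finset α} {s : ℕ}
    (hs : ∀ i ∈ G, (p' i).card = s) (Q : Finset (Finset α)) (hQ : ∅ ∉ Q) :
    (∑ L ∈ Q, edgeDegree G p' L : ℕ) ≤ G.card * (2 ^ s - 1) := by
  have : ∑ L ∈ Q, edgeDegree G p' L = ∑ i ∈ G, (Q.filter fun L => L ⊆ p' i).card := by
    simp only [edgeDegree, Finset.card_filter]
    exact Finset.sum_comm
  rw [this, ← smul_eq_mul]
  refine Finset.sum_le_card_nsmul _ _ _ fun i hi => ?_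
  rw [← hs i hi, ← Finset.card_powerset,
    ← Finset.card_erase_of_mem (Finset.empty_mem_powerset (p' i))]
  refine Finset.card_le_card fun L hL => ?_
  rw [Finset.mem_filter] at hL
  rw [Finset.mem_erase, Finset.mem_powerset]
  exact ⟨fun h => hQ (h ▸ hL.1), hL.2⟩

theorem half_card_le_card_availableEdges [DecidableEq ι] {E : Finset ι} {p : ι → Finset α}
    {U : Finset α} {D : Finset α → ℝ} {s : ℕ} {κ θ c : ℝ} (hκ : 0 < κ) (hκ1 : κ ≤ 1)
    (hD : ∀ L, 0 < D L) (hcard : ∀ i ∈ E, (p i).card = s + 1)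
    (hdeg : ∀ L : Finset α, L.Nonempty → (edgeDegree E p L : ℝ) ≤ D L)
    (hc : c * 2 ^ s ≤ 1 / 4) (hθ : ∀ v ∈ U, θ * D {v} ≤ E.card / 4)
    {D' : Finset α → ℝ} {G : Finset ι} {p' : ι → Finset α} (hG : IsPartialLink E p U D' G p')
    {X : Finset α} (hX : X ⊆ U) (hXθ : (X.card : ℝ) ≤ θ) (hGc : (G.card : ℝ) ≤ c * κ * E.card) :
    (E.card : ℝ) / 2 ≤ (availableEdges E p (fun L => κ * D L) G p' X).card := by
  classical
  set A := availableEdges E p (fun L => κ * D L) G p' X with hA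
  set Q : Finset (Finset α) := ((G.biUnion fun i => (p' i).powerset).erase ∅).filter
    fun L => κ * D L ≤ edgeDegree G p' L with hQ
  have hcover : E ⊆ A ∪ G ∪ (X.biUnion fun v => E.filter fun i => {v} ⊆ p i) ∪
      Q.biUnion fun L => E.filter fun i => L ⊆ p i := by
    intro i hi
    by_contra hcon
    simp only [Finset.mem_union, Finset.mem_biUnion, Finset.mem_filter, not_or, not_exists,
      not_and, Finset.singleton_subset_iff] at hcon
    obtain ⟨⟨⟨h1, h2⟩, h3⟩, h4⟩ := hcon
    refine h1 ?_
    rw [hA, mem_availableEdges]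
    refine ⟨hi, h2, ?_, ?_⟩
    · rw [Finset.disjoint_right]
      exact fun v hv hvi => h3 v hv hi hvi
    · intro L hL hLne
      by_contra! hlt
      refine h4 L ?_ hi hL
      have hpos : 0 < edgeDegree G p' L := by
        have := lt_of_lt_of_le (mul_pos hκ (hD L)) hlt
        exact_mod_cast this
      obtain ⟨j, hj⟩ := Finset.card_pos.1 hpos
      rw [Finset.mem_filter] at hj
      simp only [hQ, Finset.mem_filter, Finset.mem_erase, Finset.mem_biUnion, Finset.mem_powerset]
      exact ⟨⟨hLne.ne_empty, j, hj.1, hj.2⟩, hlt⟩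
  have hsumX : ∑ v ∈ X, (edgeDegree E p {v} : ℝ) ≤ E.card / 4 := by
    rcases X.eq_empty_or_nonempty with rfl | hXne
    · simp; positivity
    · have hpos : 0 < (X.card : ℝ) := by exact_mod_cast Finset.card_pos.2 hXne
      calc ∑ v ∈ X, (edgeDegree E p {v} : ℝ) ≤ ∑ v ∈ X, (E.card / 4 / X.card : ℝ) := by
            refine Finset.sum_le_sum fun v hv => ?_
            rw [le_div_iff₀ hpos]
            calc (edgeDegree E p {v} : ℝ) * X.card ≤ D {v} * θ :=
                  mul_le_mul (hdeg _ (Finset.singleton_nonempty v)) hXθ hpos.le (hD _).le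
              _ ≤ _ := by rw [mul_comm]; exact hθ v (hX hv)
        _ = _ := by rw [Finset.sum_const, nsmul_eq_mul, mul_div_cancel₀ _ hpos.ne']
  have hsumQ : κ * ∑ L ∈ Q, (edgeDegree E p L : ℝ) ≤ G.card * (2 ^ s - 1) := by
    have hQempty : ∅ ∉ Q := by simp [hQ]
    have hcard' : ∀ i ∈ G, (p' i).card = s := by
      intro i hi
      obtain ⟨v, -, hv, he⟩ := hG.eq_erase i hi
      rw [he, Finset.card_erase_of_mem hv, hcard i (hG.subset hi), Nat.add_sub_cancel]
    calc κ * ∑ L ∈ Q, (edgeDegree E p L : ℝ) ≤ ∑ L ∈ Q, (edgeDegree G p' L : ℝ) := by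
          rw [Finset.mul_sum]
          refine Finset.sum_le_sum fun L hL => ?_
          have hLne : L.Nonempty := by
            rw [Finset.nonempty_iff_ne_empty]
            exact fun h => hQempty (h ▸ hL)
          exact (mul_le_mul_of_nonneg_left (hdeg L hLne) hκ.le).trans (Finset.mem_filter.1 hL).2
      _ ≤ ((G.card * (2 ^ s - 1) : ℕ) : ℝ) := by
          exact_mod_cast sum_edgeDegree_le hcard' Q hQempty
      _ = _ := by push_cast [Nat.one_le_two_pow]; ring
  have hmain : (E.card : ℝ) ≤ A.card + G.card + ∑ v ∈ X, (edgeDegree E p {v} : ℝ) +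
      ∑ L ∈ Q, (edgeDegree E p L : ℝ) := by
    have := (Finset.card_le_card hcover).trans (Finset.card_union_le _ _)
    have h1 := Finset.card_union_le (A ∪ G) (X.biUnion fun v => E.filter fun i => {v} ⊆ p i)
    have h2 := Finset.card_union_le A G
    have h3 : (X.biUnion fun v => E.filter fun i => {v} ⊆ p i).card ≤
      ∑ v ∈ X, edgeDegree E p {v} := Finset.card_biUnion_le
    have h4 : (Q.biUnion fun L => E.filter fun i => L ⊆ p i).card ≤
      ∑ L ∈ Q, edgeDegree E p L := Finset.card_biUnion_le
    have : E.card ≤ A.card + G.card + ∑ v ∈ X, edgeDegree E p {v} +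
      ∑ L ∈ Q, edgeDegree E p L := by omega
    exact_mod_cast this
  have hpow : (1 : ℝ) ≤ 2 ^ s := one_le_pow₀ (by norm_num)
  have hGc' : (G.card : ℝ) / κ ≤ c * E.card := by
    rw [div_le_iff₀ hκ]; linarith
  have hGκ : (G.card : ℝ) ≤ G.card / κ := by
    rw [le_div_iff₀ hκ]; exact mul_le_of_le_one_right (by positivity) hκ1
  have hsumQ' : ∑ L ∈ Q, (edgeDegree E p L : ℝ) ≤ G.card / κ * (2 ^ s - 1) := by
    rw [div_mul_eq_mul_div, le_div_iff₀ hκ]; linarith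
  have h5 : (G.card : ℝ) / κ * 2 ^ s ≤ c * E.card * 2 ^ s := by gcongr
  have h6 : c * 2 ^ s * E.card ≤ 1 / 4 * E.card := by gcongr
  linarith

theorem IsPartialLink.extend [DecidableEq ι] {E : Finset ι} {p : ι → Finset α}
    {U : Finset α} {D : Finset α → ℝ} {κ : ℝ}
    (hdeg : ∀ L : Finset α, L.Nonempty → (edgeDegree E p L : ℝ) ≤ D L)
    (hD : ∀ i ∈ E, ∀ v ∈ U, v ∈ p i → ∀ L ⊆ (p i).erase v, L.Nonempty →
      D (insert v L) ≤ κ * D L)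
    {G : Finset ι} {p' : ι → Finset α} (hG : IsPartialLink E p U (fun L => 2 * (κ * D L)) G p')
    {X : Finset α} {v : α} (hv : v ∈ U) :
    IsPartialLink E p U (fun L => 2 * (κ * D L))
      (G ∪ (availableEdges E p (fun L => κ * D L) G p' X).filter fun i => {v} ⊆ p i)
      (fun i => if i ∈ G then p' i else (p i).erase v) := by
  classical
  set A := availableEdges E p (fun L => κ * D L) G p' X with hA
  have hmemA : ∀ i ∈ A, i ∈ E ∧ i ∉ G ∧
      ∀ L ⊆ p i, L.Nonempty → (edgeDegree G p' L : ℝ) < κ * D L := by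
    intro i hi
    rw [hA, mem_availableEdges] at hi
    exact ⟨hi.1, hi.2.1, hi.2.2.2⟩
  refine ⟨?_, ?_, ?_⟩
  · refine Finset.union_subset hG.subset fun i hi => ?_
    exact (hmemA i (Finset.mem_filter.1 hi).1).1
  · intro i hi
    by_cases hiG : i ∈ G
    · simpa [hiG] using hG.eq_erase i hiG
    · rw [Finset.mem_union, or_iff_right hiG, Finset.mem_filter,
        Finset.singleton_subset_iff] at hi
      exact ⟨v, hv, hi.2, by simp [hiG]⟩
  · intro L hL
    set N := A.filter fun i => v ∈ p i ∧ L ⊆ (p i).erase v with hN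
    have hsub : (G ∪ A.filter fun i => {v} ⊆ p i).filter
        (fun i => L ⊆ if i ∈ G then p' i else (p i).erase v) ⊆
        (G.filter fun i => L ⊆ p' i) ∪ N := by
      intro i hi
      simp only [Finset.mem_filter, Finset.mem_union, Finset.singleton_subset_iff, hN] at hi ⊢
      by_cases hiG : i ∈ G
      · simp only [hiG, if_true] at hi
        exact Or.inl ⟨hiG, hi.2⟩
      · simp only [hiG, if_false, false_or] at hi
        exact Or.inr ⟨hi.1.1, hi.1.2, hi.2⟩
    have hle := (Finset.card_le_card hsub).trans (Finset.card_union_le _ _)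
    have hle' : (edgeDegree (G ∪ A.filter fun i => {v} ⊆ p i)
        (fun i => if i ∈ G then p' i else (p i).erase v) L : ℝ) ≤ edgeDegree G p' L + N.card := by
      exact_mod_cast hle
    rcases N.eq_empty_or_nonempty with h0 | ⟨i, hi⟩
    · rw [h0, Finset.card_empty, Nat.cast_zero, add_zero] at hle'
      exact hle'.trans (hG.degree_le L hL)
    · rw [hN, Finset.mem_filter] at hi
      obtain ⟨hiE, -, hsat⟩ := hmemA i hi.1
      have h1 := hsat L (hi.2.2.trans (Finset.erase_subset _ _)) hL
      have h2 : (N.card : ℝ) ≤ edgeDegree E p (insert v L) := by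
        refine Nat.cast_le.2 (Finset.card_le_card fun j hj => ?_)
        rw [hN, Finset.mem_filter] at hj
        rw [Finset.mem_filter]
        exact ⟨(hmemA j hj.1).1, Finset.insert_subset hj.2.1
          (hj.2.2.trans (Finset.erase_subset _ _))⟩
      have h3 := hdeg (insert v L) (Finset.insert_nonempty _ _)
      have h4 := hD i hiE v hv hi.2.1 L hi.2.2 hL
      linarith

theorem exists_queryTree_of_isPartialLink [DecidableEq ι] {E : Finset ι} (hE : E.Nonempty)
    {p : ι → Finset α} {U : Finset α} {D : Finset α → ℝ} {s b : ℕ} {M θ c : ℝ}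
    (hb : 0 < b) (hbM : (b : ℝ) ≤ M)
    (hD : ∀ L, 0 < D L) (hcard : ∀ i ∈ E, (p i).card = s + 1)
    (hdeg : ∀ L : Finset α, L.Nonempty → (edgeDegree E p L : ℝ) ≤ D L)
    (hDstep : ∀ i ∈ E, ∀ v ∈ U, v ∈ p i → ∀ L ⊆ (p i).erase v, L.Nonempty →
      D (insert v L) ≤ b / M * D L)
    (hc0 : 0 < c) (hc : c * 2 ^ s ≤ 1 / 4) (hθ : ∀ v ∈ U, θ * D {v} ≤ E.card / 4)
    (k : ℕ) {G : Finset ι} {p' : ι → Finset α} {X : Finset α}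
    (hG : IsPartialLink E p U (fun L => 2 * (b / M * D L)) G p')
    (hGcard : ((b : ℝ) - k) * (E.card / (2 * M)) ≤ G.card) (hX : X ⊆ U) :
    ∃ t : QueryTree α (Finset ι × (ι → Finset α)), ∀ W : Finset α,
      (∀ i ∈ E, ¬ p i ⊆ W) →
      (∀ A ⊆ E, A.Nonempty → ∃ v ∈ U, (A.card : ℝ) ≤ M * edgeDegree A p {v}) →
      (∀ i ∈ G, ¬ p' i ⊆ W) →
      t.fingerprint W ⊆ U ∧ (t.fingerprint W).card ≤ k ∧ t.excluded W ⊆ U ∧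
      (((t.output W).1 = ∅ ∧ θ ≤ (X ∪ t.excluded W).card) ∨
        (c * (b / M) * E.card ≤ (t.output W).1.card ∧
          IsPartialLink E p U (fun L => 2 * (b / M * D L)) (t.output W).1 (t.output W).2 ∧
          ∀ i ∈ (t.output W).1, ¬ (t.output W).2 i ⊆ W)) := by
  classical
  have hb' : (0 : ℝ) < b := by exact_mod_cast hb
  have hM : 0 < M := hb'.trans_le hbM
  have hEpos : (0 : ℝ) < E.card := by exact_mod_cast Finset.card_pos.2 hE
  have hpow : (1 : ℝ) ≤ 2 ^ s := one_le_pow₀ (by norm_num)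
  induction hN : k + (U \ X).card using Nat.strong_induction_on generalizing k G p' X with
  | _ N ih =>
  subst hN
  by_cases hXθ : θ ≤ X.card
  · refine ⟨.leaf (∅, p'), fun W _ _ _ => ?_⟩
    simpa [QueryTree.fingerprint, QueryTree.excluded, QueryTree.output] using Or.inl hXθ
  by_cases hGc : c * (b / M) * E.card ≤ G.card
  · refine ⟨.leaf (G, p'), fun W _ _ hW => ?_⟩
    simpa [QueryTree.fingerprint, QueryTree.excluded, QueryTree.output] using
      Or.inr ⟨hGc, hG, hW⟩
  push Not at hXθ hGc
  set A := availableEdges E p (fun L => b / M * D L) G p' X with hA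
  have hAcard : (E.card : ℝ) / 2 ≤ A.card :=
    half_card_le_card_availableEdges (by positivity) ((div_le_one hM).2 hbM) hD hcard hdeg hc hθ
      hG hX hXθ.le hGc.le
  have hAE : A ⊆ E := fun i hi => (mem_availableEdges.1 hi).1
  have hAne : A.Nonempty := by
    rw [← Finset.card_pos]
    have : (0 : ℝ) < A.card := by linarith
    exact_mod_cast this
  by_cases hv : ∃ v ∈ U, (A.card : ℝ) ≤ M * edgeDegree A p {v}
  swap
  · exact ⟨.leaf (∅, p'), fun W _ hW => absurd (hW A hAE hAne) hv⟩
  obtain ⟨v, hvU, hv⟩ := hv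
  have hdegv : (E.card : ℝ) / (2 * M) ≤ edgeDegree A p {v} := by
    rw [div_le_iff₀ (by positivity)]; linarith
  have hvX : v ∉ X := by
    have : 0 < edgeDegree A p {v} := by
      have : (0 : ℝ) < edgeDegree A p {v} := lt_of_lt_of_le (by positivity) hdegv
      exact_mod_cast this
    obtain ⟨i, hi⟩ := Finset.card_pos.1 this
    rw [Finset.mem_filter, Finset.singleton_subset_iff] at hi
    exact Finset.disjoint_left.1 (mem_availableEdges.1 hi.1).2.2.1 hi.2
  obtain ⟨k, rfl⟩ : ∃ l, k = l + 1 := by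
    refine Nat.exists_eq_succ_of_ne_zero fun h0 => ?_
    subst h0
    have hc4 : c ≤ 1 / 4 := by nlinarith
    have h1 : c * (b / M) * E.card ≤ 1 / 4 * (b / M) * E.card := by gcongr
    have h2 : ((b : ℝ) - (0 : ℕ)) * (E.card / (2 * M)) = 1 / 2 * (b / M * E.card) := by
      push_cast; field_simp; ring
    have h3 : 0 < (b / M * E.card : ℝ) := by positivity
    linarith
  have hGA : Disjoint G (A.filter fun i => {v} ⊆ p i) :=
    Finset.disjoint_left.2 fun i hi hi' =>
      (mem_availableEdges.1 (Finset.mem_filter.1 hi').1).2.1 hi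
  obtain ⟨ty, hy⟩ := ih (k + (U \ X).card) (by omega) k
    (G := G ∪ A.filter fun i => {v} ⊆ p i) (p' := fun i => if i ∈ G then p' i else (p i).erase v)
    (hG.extend hdeg hDstep hvU)
    (by
      rw [Finset.card_union_of_disjoint hGA, Nat.cast_add]
      change _ ≤ (G.card : ℝ) + (edgeDegree A p {v} : ℕ)
      push_cast at hGcard
      linarith)
    hX rfl
  obtain ⟨tn, hn⟩ := ih (k + 1 + (U \ insert v X).card)
    (by
      have : (U \ insert v X).card < (U \ X).card :=
        Finset.card_lt_card (Finset.ssubset_iff_of_subset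
          (Finset.sdiff_subset_sdiff subset_rfl (Finset.subset_insert v X)) |>.2
          ⟨v, by simp [hvU, hvX], by simp⟩)
      omega)
    (k + 1) hG hGcard (Finset.insert_subset hvU hX) rfl
  refine ⟨.node v ty tn, fun W hWE hWM hWG => ?_⟩
  by_cases hvW : v ∈ W
  · obtain ⟨h1, h2, h3, h4⟩ := hy W hWE hWM (by
      intro i hi
      by_cases hiG : i ∈ G
      · simpa [hiG] using hWG i hiG
      · rw [Finset.mem_union, or_iff_right hiG, Finset.mem_filter] at hi
        simp only [hiG, if_false]
        rw [← Finset.subset_insert_iff, Finset.insert_eq_of_mem hvW]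
        exact hWE i (hAE hi.1))
    simp only [QueryTree.fingerprint, QueryTree.excluded, QueryTree.output, hvW, if_true]
    exact ⟨Finset.insert_subset hvU h1, (Finset.card_insert_le _ _).trans (by omega), h3, h4⟩
  · obtain ⟨h1, h2, h3, h4⟩ := hn W hWE hWM hWG
    simp only [QueryTree.fingerprint, QueryTree.excluded, QueryTree.output, hvW, if_false]
    refine ⟨h1, h2, Finset.insert_subset hvU h3, ?_⟩
    rwa [Finset.union_insert, ← Finset.insert_union]

theorem exists_queryTree_partialLink {E : Finset ι} (hE : E.Nonempty)
    {p : ι → Finset α} {U : Finset α} {D : Finset α → ℝ} {s b : ℕ} {M θ : ℝ}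
    (hb : 0 < b) (hbM : (b : ℝ) ≤ M)
    (hD : ∀ L, 0 < D L) (hcard : ∀ i ∈ E, (p i).card = s + 1)
    (hdeg : ∀ L : Finset α, L.Nonempty → (edgeDegree E p L : ℝ) ≤ D L)
    (hDstep : ∀ i ∈ E, ∀ v ∈ U, v ∈ p i → ∀ L ⊆ (p i).erase v, L.Nonempty →
      D (insert v L) ≤ b / M * D L)
    (hθ : ∀ v ∈ U, θ * D {v} ≤ E.card / 4) :
    ∃ t : QueryTree α (Finset ι × (ι → Finset α)), ∀ W : Finset α,
      (∀ i ∈ E, ¬ p i ⊆ W) →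
      (∀ A ⊆ E, A.Nonempty → ∃ v ∈ U, (A.card : ℝ) ≤ M * edgeDegree A p {v}) →
      t.fingerprint W ⊆ U ∧ (t.fingerprint W).card ≤ b ∧ t.excluded W ⊆ U ∧
      (((t.output W).1 = ∅ ∧ θ ≤ (t.excluded W).card) ∨
        (b / M * E.card ≤ 2 ^ (s + 2) * (t.output W).1.card ∧
          IsPartialLink E p U (fun L => 2 * (b / M * D L)) (t.output W).1 (t.output W).2 ∧
          ∀ i ∈ (t.output W).1, ¬ (t.output W).2 i ⊆ W)) := by
  classical
  have hM : 0 < M := lt_of_lt_of_le (by exact_mod_cast hb) hbM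
  obtain ⟨t, ht⟩ := exists_queryTree_of_isPartialLink hE hb hbM hD hcard hdeg hDstep
    (c := 1 / 2 ^ (s + 2)) (by positivity) (by rw [pow_add]; field_simp; norm_num) hθ b
    (G := ∅) (p' := p) (X := ∅)
    ⟨Finset.empty_subset _, by simp, fun L _ => by
      have := hD L
      simp only [edgeDegree, Finset.filter_empty, Finset.card_empty, Nat.cast_zero]
      positivity⟩ (by simp) (Finset.empty_subset _)
  refine ⟨t, fun W h1 h2 => ?_⟩
  obtain ⟨a1, a2, a3, a4⟩ := ht W h1 h2 (by simp)
  refine ⟨a1, a2, a3, a4.imp (fun h => by simpa using h) (fun h => ⟨?_, h.2⟩)⟩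
  have := h.1
  rw [mul_assoc, one_div, inv_mul_le_iff₀ (by positivity)] at this
  exact this

end Stage

/-- The weight `b ^ (a + c - 1) / (m ^ a * n ^ c) * (m / q) ^ [a > 0]` bounding the codegrees of
pairs of sets of sizes `a` and `c`. -/
noncomputable def codegreeWeight (b m q n : ℝ) (a c : ℕ) : ℝ :=
  b ^ (a + c - 1) / (m ^ a * n ^ c) * (m / q) ^ (if 0 < a then 1 else 0)

section Weight

variable {b m q n : ℝ}

theorem codegreeWeight_pos (hb : 0 < b) (hm : 0 < m) (hq : 0 < q) (hn : 0 < n) (a c : ℕ) :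
    0 < codegreeWeight b m q n a c := by
  unfold codegreeWeight; positivity

theorem codegreeWeight_one_zero (hm : 0 < m) : codegreeWeight b m q n 1 0 = 1 / q := by
  simp [codegreeWeight]; field_simp

theorem codegreeWeight_zero_one : codegreeWeight b m q n 0 1 = 1 / n := by
  simp [codegreeWeight]

theorem codegreeWeight_add_one_right {a c : ℕ} (h : a + c ≠ 0) :
    codegreeWeight b m q n a (c + 1) = b / n * codegreeWeight b m q n a c := by
  obtain ⟨l, hl⟩ := Nat.exists_eq_succ_of_ne_zero h
  have h1 : a + (c + 1) - 1 = l + 1 := by omega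
  have h2 : a + c - 1 = l := by omega
  rw [codegreeWeight, codegreeWeight, h1, h2, pow_succ, pow_succ]
  ring

theorem codegreeWeight_add_one_left {a c : ℕ} (h : a ≠ 0) :
    codegreeWeight b m q n (a + 1) c = b / m * codegreeWeight b m q n a c := by
  obtain ⟨l, rfl⟩ := Nat.exists_eq_succ_of_ne_zero h
  have h1 : l + 1 + 1 + c - 1 = l + c + 1 := by omega
  have h2 : l + 1 + c - 1 = l + c := by omega
  simp only [codegreeWeight, h1, h2, Nat.succ_eq_add_one, Nat.succ_pos, if_true, pow_succ]
  ring

end Weight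

/-- A non-empty family of edges with `s₀` vertices in `V₀` and `s₁` vertices in `V₁` each, whose
codegrees are bounded by `K` times the codegree weight times the number of edges. -/
structure IsSpreadFamily {ι α : Type*} [DecidableEq α] (V₀ V₁ : Finset α) (b m q : ℕ)
    (s₀ s₁ : ℕ) (K : ℝ) (E : Finset ι) (p : ι → Finset α) : Prop where
  nonempty : E.Nonempty
  subset : ∀ i ∈ E, p i ⊆ V₀ ∪ V₁
  card_left : ∀ i ∈ E, (p i ∩ V₀).card = s₀
  card_right : ∀ i ∈ E, (p i ∩ V₁).card = s₁
  degree_le : ∀ L : Finset α, L.Nonempty → (edgeDegree E p L : ℝ) ≤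
    K * codegreeWeight b m q V₁.card (L ∩ V₀).card (L ∩ V₁).card * E.card

/-- Running `t` on a set `W` containing no edge and missing few vertices of `V₀` produces a small
fingerprint and excludes many vertices. -/
def IsContainerTree {ι α : Type*} [DecidableEq α] (V₀ V₁ : Finset α) (b m q : ℕ)
    (s₀ s₁ : ℕ) (δ : ℝ) (E : Finset ι) (p : ι → Finset α) (t : QueryTree α Unit) : Prop :=
  ∀ W : Finset α, (V₀ \ W).card ≤ m → (∀ i ∈ E, ¬ p i ⊆ W) →
    t.fingerprint W ⊆ V₀ ∪ V₁ ∧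
    (t.fingerprint W ∩ V₀).card ≤ s₀ * b ∧
    (t.fingerprint W ∩ V₁).card ≤ s₁ * b ∧
    (δ * q ≤ (t.excluded W ∩ V₀).card ∨
      s₁ ≠ 0 ∧ t.fingerprint W ∩ V₀ = ∅ ∧ δ * V₁.card ≤ (t.excluded W ∩ V₁).card)

section Container

variable {ι α : Type*} [DecidableEq α] {V₀ V₁ : Finset α} {b m q : ℕ} {E : Finset ι}
  {p : ι → Finset α} {K δ : ℝ}

theorem IsSpreadFamily.card_eq (hdisj : Disjoint V₀ V₁) {s₀ s₁ : ℕ}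
    (hE : IsSpreadFamily V₀ V₁ b m q s₀ s₁ K E p) {i : ι} (hi : i ∈ E) :
    (p i).card = s₀ + s₁ := by
  rw [← hE.card_left i hi, ← hE.card_right i hi, ← Finset.card_union_of_disjoint
    (Finset.disjoint_of_subset_left Finset.inter_subset_right
      (Finset.disjoint_of_subset_right Finset.inter_subset_right hdisj)),
    ← Finset.inter_union_distrib_left, Finset.inter_eq_left.2 (hE.subset i hi)]

theorem card_le_mul_card_of_edgeDegree_le {Q c : ℝ} (hQ : 0 < Q) (hE : E.Nonempty)
    (h : ∀ i ∈ E, (p i).Nonempty) {X : Finset α} (hX : X = E.biUnion p)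
    (hdeg : ∀ v ∈ X, (edgeDegree E p {v} : ℝ) ≤ c * (1 / Q) * E.card) : Q ≤ c * X.card := by
  have h1 : (E.card : ℝ) ≤ ∑ v ∈ X, (edgeDegree E p {v} : ℝ) := by
    classical
    have : E ⊆ X.biUnion fun v => E.filter fun i => {v} ⊆ p i := by
      intro i hi
      obtain ⟨v, hv⟩ := h i hi
      simp only [Finset.mem_biUnion, Finset.mem_filter, Finset.singleton_subset_iff]
      exact ⟨v, hX ▸ Finset.mem_biUnion.2 ⟨i, hi, hv⟩, hi, hv⟩
    exact_mod_cast (Finset.card_le_card this).trans Finset.card_biUnion_le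
  have h2 := h1.trans (Finset.sum_le_sum hdeg)
  have hEpos : (0 : ℝ) < E.card := by exact_mod_cast Finset.card_pos.2 hE
  rw [Finset.sum_const, nsmul_eq_mul] at h2
  have h3 : (E.card : ℝ) * Q ≤ E.card * (c * X.card) := by
    calc (E.card : ℝ) * Q ≤ (X.card * (c * (1 / Q) * E.card)) * Q := by gcongr
      _ = _ := by field_simp
  exact le_of_mul_le_mul_left h3 hEpos

theorem IsSpreadFamily.exists_isContainerTree_of_eq_one (hm : 0 < m) (hq : 0 < q)
    (hdisj : Disjoint V₀ V₁) (hn : 0 < V₁.card) {s₀ s₁ : ℕ} (hs : s₀ + s₁ = 1) (hδ : 0 < δ)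
    (hK : K * δ ≤ 1) (hE : IsSpreadFamily V₀ V₁ b m q s₀ s₁ K E p) :
    ∃ t, IsContainerTree V₀ V₁ b m q s₀ s₁ δ E p t := by
  classical
  have hcard : ∀ i ∈ E, (p i).card = 1 := fun i hi => (hE.card_eq hdisj hi).trans hs
  have hne : ∀ i ∈ E, (p i).Nonempty := fun i hi => by
    rw [← Finset.card_pos, hcard i hi]; exact one_pos
  set X := E.biUnion p with hX
  obtain ⟨t, ht⟩ := QueryTree.exists_forall_excluded_eq X
  refine ⟨t, fun W _ hW => ?_⟩
  have hXW : Disjoint X W := by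
    rw [hX, Finset.disjoint_biUnion_left]
    intro i hi
    obtain ⟨v, hv⟩ := Finset.card_eq_one.1 (hcard i hi)
    have := hW i hi
    rw [hv, Finset.singleton_subset_iff] at this
    rwa [hv, Finset.disjoint_singleton_left]
  obtain ⟨h1, h2⟩ := ht W hXW
  refine ⟨by simp [h1], by simp [h1], by simp [h1], ?_⟩
  rw [h1, h2]
  have key : ∀ (Q : ℝ), 0 < Q → (∀ v ∈ X, (edgeDegree E p {v} : ℝ) ≤ K * (1 / Q) * E.card) →
      δ * Q ≤ X.card := by
    intro Q hQ hd
    have := card_le_mul_card_of_edgeDegree_le hQ hE.nonempty hne hX hd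
    calc δ * Q ≤ δ * (K * X.card) := by gcongr
      _ = K * δ * X.card := by ring
      _ ≤ 1 * X.card := by gcongr
      _ = _ := one_mul _
  have hvdeg : ∀ v, (edgeDegree E p {v} : ℝ) ≤ _ :=
    fun v => hE.degree_le {v} (Finset.singleton_nonempty v)
  obtain ⟨rfl, rfl⟩ | ⟨rfl, rfl⟩ : (s₀ = 1 ∧ s₁ = 0) ∨ (s₀ = 0 ∧ s₁ = 1) := by omega
  · have hXV : X ⊆ V₀ := by
      refine Finset.biUnion_subset.2 fun i hi => ?_
      rw [← Finset.inter_eq_left]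
      exact Finset.eq_of_subset_of_card_le Finset.inter_subset_left
        (by rw [hcard i hi, hE.card_left i hi])
    left
    rw [Finset.inter_eq_left.2 hXV]
    refine key q (by exact_mod_cast hq) fun v hv => ?_
    have := hvdeg v
    rwa [Finset.singleton_inter_of_mem (hXV hv), Finset.singleton_inter_of_notMem
      (Finset.disjoint_left.1 hdisj (hXV hv)), Finset.card_singleton, Finset.card_empty,
      codegreeWeight_one_zero (by exact_mod_cast hm)] at this
  · have hXV : X ⊆ V₁ := by
      refine Finset.biUnion_subset.2 fun i hi => ?_
      rw [← Finset.inter_eq_left]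
      exact Finset.eq_of_subset_of_card_le Finset.inter_subset_left
        (by rw [hcard i hi, hE.card_right i hi])
    refine Or.inr ⟨one_ne_zero, by simp, ?_⟩
    rw [Finset.inter_eq_left.2 hXV]
    refine key _ (by exact_mod_cast hn) fun v hv => ?_
    have := hvdeg v
    rwa [Finset.singleton_inter_of_mem (hXV hv), Finset.singleton_inter_of_notMem
      (Finset.disjoint_right.1 hdisj (hXV hv)), Finset.card_singleton, Finset.card_empty,
      codegreeWeight_zero_one] at this

theorem IsSpreadFamily.of_isPartialLink {s s₀ s₁ s₀' s₁' : ℕ} {κ : ℝ} (hκ : 0 < κ) (hK : 0 < K)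
    (hb : 0 < b) (hm : 0 < m) (hq : 0 < q) (hn : 0 < V₁.card)
    (hE : IsSpreadFamily V₀ V₁ b m q s₀ s₁ K E p) {U : Finset α} {G : Finset ι}
    {p' : ι → Finset α}
    (hG : IsPartialLink E p U (fun L => 2 * (κ *
      (K * codegreeWeight b m q V₁.card (L ∩ V₀).card (L ∩ V₁).card * E.card))) G p')
    (hcard : κ * E.card ≤ 2 ^ (s + 2) * G.card)
    (h₀ : ∀ i ∈ E, ∀ v ∈ U, v ∈ p i → ((p i).erase v ∩ V₀).card = s₀')
    (h₁ : ∀ i ∈ E, ∀ v ∈ U, v ∈ p i → ((p i).erase v ∩ V₁).card = s₁') :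
    IsSpreadFamily V₀ V₁ b m q s₀' s₁' (K * 2 ^ (s + 3)) G p' where
  nonempty := by
    have hEpos : (0 : ℝ) < E.card := by exact_mod_cast Finset.card_pos.2 hE.nonempty
    rw [← Finset.card_pos]
    by_contra! h0
    rw [Nat.le_zero.1 h0] at hcard
    have := mul_pos hκ hEpos
    simp at hcard
    linarith
  subset i hi := by
    obtain ⟨v, -, -, he⟩ := hG.eq_erase i hi
    rw [he]
    exact (Finset.erase_subset _ _).trans (hE.subset i (hG.subset hi))
  card_left i hi := by
    obtain ⟨v, hv, hvi, he⟩ := hG.eq_erase i hi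
    rw [he]
    exact h₀ i (hG.subset hi) v hv hvi
  card_right i hi := by
    obtain ⟨v, hv, hvi, he⟩ := hG.eq_erase i hi
    rw [he]
    exact h₁ i (hG.subset hi) v hv hvi
  degree_le L hL := by
    refine (hG.degree_le L hL).trans ?_
    have hw := codegreeWeight_pos (b := b) (m := m) (q := q) (n := V₁.card)
      (by exact_mod_cast hb) (by exact_mod_cast hm) (by exact_mod_cast hq)
      (by exact_mod_cast hn) (L ∩ V₀).card (L ∩ V₁).card
    set w := codegreeWeight b m q V₁.card (L ∩ V₀).card (L ∩ V₁).card
    calc 2 * (κ * (K * w * E.card)) = 2 * (K * w) * (κ * E.card) := by ring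
      _ ≤ 2 * (K * w) * (2 ^ (s + 2) * G.card) := by gcongr
      _ = _ := by ring

theorem IsSpreadFamily.exists_queryTree_step {s s₀ s₁ s₀' s₁' : ℕ} {U : Finset α} {M θ : ℝ}
    (hK : 0 < K) (hb : 0 < b) (hm : 0 < m) (hq : 0 < q) (hn : 0 < V₁.card) (hbM : (b : ℝ) ≤ M)
    (hdisj : Disjoint V₀ V₁) (hs : s₀ + s₁ = s + 1)
    (hE : IsSpreadFamily V₀ V₁ b m q s₀ s₁ K E p)
    (hstep : ∀ i ∈ E, ∀ v ∈ U, v ∈ p i → ∀ L ⊆ (p i).erase v, L.Nonempty →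
      codegreeWeight b m q V₁.card (insert v L ∩ V₀).card (insert v L ∩ V₁).card ≤
        b / M * codegreeWeight b m q V₁.card (L ∩ V₀).card (L ∩ V₁).card)
    (hθ : ∀ v ∈ U, θ * (K * codegreeWeight b m q V₁.card ({v} ∩ V₀).card ({v} ∩ V₁).card) ≤ 1 / 4)
    (h₀ : ∀ i ∈ E, ∀ v ∈ U, v ∈ p i → ((p i).erase v ∩ V₀).card = s₀')
    (h₁ : ∀ i ∈ E, ∀ v ∈ U, v ∈ p i → ((p i).erase v ∩ V₁).card = s₁')
    (hU : ∀ W : Finset α, (V₀ \ W).card ≤ m → (∀ i ∈ E, ¬ p i ⊆ W) →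
      ∃ T ⊆ U, (T.card : ℝ) ≤ M ∧ ∀ i ∈ E, ∃ v ∈ T, v ∈ p i)
    (ih : ∀ (G : Finset ι) (p' : ι → Finset α),
      IsSpreadFamily V₀ V₁ b m q s₀' s₁' (K * 2 ^ (s + 3)) G p' →
        ∃ t, IsContainerTree V₀ V₁ b m q s₀' s₁' δ G p' t) :
    ∃ t : QueryTree α Unit, ∀ W : Finset α, (V₀ \ W).card ≤ m → (∀ i ∈ E, ¬ p i ⊆ W) →
      ∃ S X S' X' : Finset α, t.fingerprint W = S ∪ S' ∧ t.excluded W = X ∪ X' ∧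
        S ⊆ U ∧ S.card ≤ b ∧ X ⊆ U ∧ (S' = ∅ ∧ θ ≤ X.card ∨
          S' ⊆ V₀ ∪ V₁ ∧ (S' ∩ V₀).card ≤ s₀' * b ∧ (S' ∩ V₁).card ≤ s₁' * b ∧
          (δ * q ≤ (X' ∩ V₀).card ∨
            s₁' ≠ 0 ∧ S' ∩ V₀ = ∅ ∧ δ * V₁.card ≤ (X' ∩ V₁).card)) := by
  classical
  have hM : 0 < M := lt_of_lt_of_le (by exact_mod_cast hb) hbM
  have hEpos : (0 : ℝ) < E.card := by exact_mod_cast Finset.card_pos.2 hE.nonempty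
  have hw : ∀ a c, 0 < codegreeWeight b m q V₁.card a c := codegreeWeight_pos
    (by exact_mod_cast hb) (by exact_mod_cast hm) (by exact_mod_cast hq) (by exact_mod_cast hn)
  obtain ⟨t, ht⟩ := exists_queryTree_partialLink hE.nonempty (U := U) (s := s) (θ := θ)
    (D := fun L => K * codegreeWeight b m q V₁.card (L ∩ V₀).card (L ∩ V₁).card * E.card)
    hb hbM (fun L => mul_pos (mul_pos hK (hw _ _)) hEpos)
    (fun i hi => (hE.card_eq hdisj hi).trans hs) hE.degree_le
    (fun i hi v hv hvi L hL hLne => by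
      have := mul_le_mul_of_nonneg_left (hstep i hi v hv hvi L hL hLne)
        (mul_pos hK hEpos).le
      linarith)
    (fun v hv => by
      have := mul_le_mul_of_nonneg_right (hθ v hv) hEpos.le
      linarith)
  have hex : ∀ x : Finset ι × (ι → Finset α), ∃ t' : QueryTree α Unit,
      (x.1 = ∅ → t' = .leaf ()) ∧
      (IsSpreadFamily V₀ V₁ b m q s₀' s₁' (K * 2 ^ (s + 3)) x.1 x.2 →
        IsContainerTree V₀ V₁ b m q s₀' s₁' δ x.1 x.2 t') := by
    intro x
    by_cases hx : IsSpreadFamily V₀ V₁ b m q s₀' s₁' (K * 2 ^ (s + 3)) x.1 x.2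
    · obtain ⟨t', ht'⟩ := ih x.1 x.2 hx
      exact ⟨t', fun h => absurd h hx.nonempty.ne_empty, fun _ => ht'⟩
    · exact ⟨.leaf (), fun _ => rfl, fun h => absurd h hx⟩
  choose k hk hk' using hex
  refine ⟨t.bind k, fun W hW hWE => ?_⟩
  obtain ⟨T, hTU, hTM, hT⟩ := hU W hW hWE
  obtain ⟨a1, a2, a3, a4⟩ := ht W hWE fun A hA hAne => by
    obtain ⟨v, hv, h⟩ := exists_card_le_mul_edgeDegree hAne hTM fun i hi => hT i (hA hi)
    exact ⟨v, hTU hv, h⟩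
  refine ⟨_, _, _, _, t.fingerprint_bind k W, t.excluded_bind k W, a1, a2, a3, ?_⟩
  rcases a4 with ⟨h1, h2⟩ | ⟨h1, h2, h3⟩
  · left
    rw [hk _ h1]
    exact ⟨rfl, h2⟩
  · right
    exact hk' _ (hE.of_isPartialLink (div_pos (by exact_mod_cast hb) hM) hK hb hm hq hn h2 h1
      h₀ h₁) W hW h3

theorem IsSpreadFamily.exists_isContainerTree (hb : 0 < b) (hm : 0 < m) (hq : 0 < q)
    (hbm : b ≤ m) (hbV : b ≤ V₁.card) (hdisj : Disjoint V₀ V₁) (hδ : 0 < δ) (s : ℕ)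
    {s₀ s₁ : ℕ} (hs : s₀ + s₁ = s + 1) (hK : 0 < K)
    (hKδ : K * δ * 2 ^ (∑ i ∈ Finset.range s, (i + 4)) ≤ 1)
    (hE : IsSpreadFamily V₀ V₁ b m q s₀ s₁ K E p) :
    ∃ t, IsContainerTree V₀ V₁ b m q s₀ s₁ δ E p t := by
  classical
  have hn : 0 < V₁.card := hb.trans_le hbV
  induction s generalizing s₀ s₁ K E p with
  | zero => exact hE.exists_isContainerTree_of_eq_one hm hq hdisj hn hs hδ (by simpa using hKδ)
  | succ s ih =>
  rw [Finset.sum_range_succ, pow_add] at hKδ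
  have hKδ4 : δ * K ≤ 1 / 4 := by
    have h1 : (1 : ℝ) ≤ 2 ^ (∑ i ∈ Finset.range s, (i + 4)) := one_le_pow₀ (by norm_num)
    have h2 : (4 : ℝ) ≤ 2 ^ (s + 4) := by
      rw [pow_add]
      have : (1 : ℝ) ≤ 2 ^ s := one_le_pow₀ (by norm_num)
      linarith
    have h3 : (4 : ℝ) ≤ 2 ^ (∑ i ∈ Finset.range s, (i + 4)) * 2 ^ (s + 4) := by nlinarith
    have h4 : K * δ * 4 ≤ K * δ * (2 ^ (∑ i ∈ Finset.range s, (i + 4)) * 2 ^ (s + 4)) := by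
      gcongr
    linarith
  have hKδ' : K * 2 ^ (s + 1 + 3) * δ * 2 ^ (∑ i ∈ Finset.range s, (i + 4)) ≤ 1 := by
    calc _ = K * δ * (2 ^ (∑ i ∈ Finset.range s, (i + 4)) * 2 ^ (s + 4)) := by ring
      _ ≤ 1 := hKδ
  rcases Nat.eq_zero_or_pos s₁ with rfl | hs₁
  · have hpV : ∀ i ∈ E, p i ⊆ V₀ := by
      intro i hi
      rw [← Finset.inter_eq_left]
      exact Finset.eq_of_subset_of_card_le Finset.inter_subset_left
        (by rw [hE.card_left i hi, hE.card_eq hdisj hi, add_zero])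
    obtain ⟨t, ht⟩ := hE.exists_queryTree_step (s := s + 1) (s₀' := s + 1) (s₁' := 0) (U := V₀)
      (M := m) (θ := δ * q) (δ := δ) hK hb hm hq hn (by exact_mod_cast hbm) hdisj hs
      (fun i hi v hv hvi L hL hLne => by
        have hLV : L ⊆ V₀ := (hL.trans (Finset.erase_subset _ _)).trans (hpV i hi)
        rw [Finset.insert_inter_of_mem hv,
          Finset.insert_inter_of_notMem (Finset.disjoint_left.1 hdisj hv),
          Finset.inter_eq_left.2 hLV, Finset.card_insert_of_notMem fun h => by simpa using hL h,
          codegreeWeight_add_one_left (Finset.card_pos.2 hLne).ne'])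
      (fun v hv => by
        rw [Finset.singleton_inter_of_mem hv,
          Finset.singleton_inter_of_notMem (Finset.disjoint_left.1 hdisj hv),
          Finset.card_singleton, Finset.card_empty,
          codegreeWeight_one_zero (by exact_mod_cast hm)]
        have : (q : ℝ) ≠ 0 := by exact_mod_cast hq.ne'
        field_simp
        linarith)
      (fun i hi v hv hvi => by
        rw [Finset.inter_eq_left.2 ((Finset.erase_subset _ _).trans (hpV i hi)),
          Finset.card_erase_of_mem hvi, hE.card_eq hdisj hi]
        omega)
      (fun i hi v hv hvi => by
        have := hE.card_right i hi
        rw [Finset.card_eq_zero] at this ⊢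
        exact Finset.subset_empty.1 (this ▸ Finset.inter_subset_inter_right
          (Finset.erase_subset _ _)))
      (fun W hW hWE => by
        refine ⟨V₀ \ W, Finset.sdiff_subset, by exact_mod_cast hW, fun i hi => ?_⟩
        obtain ⟨v, hv, hvW⟩ := Finset.not_subset.1 (hWE i hi)
        exact ⟨v, Finset.mem_sdiff.2 ⟨hpV i hi hv, hvW⟩, hv⟩)
      (fun G p' hG => ih (by omega) (by positivity) hKδ' hG)
    refine ⟨t, fun W hW hWE => ?_⟩
    obtain ⟨S, X, S', X', hS, hX, hSV, hSb, hXV, h⟩ := ht W hW hWE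
    have hSV₁ : S ∩ V₁ = ∅ := Finset.disjoint_iff_inter_eq_empty.1
      (Finset.disjoint_of_subset_left hSV hdisj)
    rw [hS, hX, Finset.union_inter_distrib_right, Finset.union_inter_distrib_right, hSV₁,
      Finset.inter_eq_left.2 hSV, Finset.empty_union]
    have hs₀ : s₀ * b = b + (s + 1) * b := by
      rw [show s₀ = s + 1 + 1 by omega]; ring
    rcases h with ⟨rfl, hθ⟩ | ⟨h1, h2, h3, h4⟩
    · refine ⟨by simpa using hSV.trans Finset.subset_union_left, by simpa using by omega,
        by simp, Or.inl ?_⟩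
      refine hθ.trans ?_
      gcongr
      exact Finset.subset_inter Finset.subset_union_left hXV
    · refine ⟨Finset.union_subset (hSV.trans Finset.subset_union_left) h1,
        (Finset.card_union_le _ _).trans (by omega), h3, Or.inl ?_⟩
      refine (h4.resolve_right fun h => h.1 rfl).trans ?_
      gcongr
      exact Finset.subset_union_right
  · obtain ⟨s₁, rfl⟩ := Nat.exists_eq_succ_of_ne_zero hs₁.ne'
    obtain ⟨t, ht⟩ := hE.exists_queryTree_step (s := s + 1) (s₀' := s₀) (s₁' := s₁) (U := V₁)
      (M := V₁.card) (θ := δ * V₁.card) (δ := δ) hK hb hm hq hn (by exact_mod_cast hbV) hdisj hs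
      (fun i hi v hv hvi L hL hLne => by
        have hLV : L ⊆ V₀ ∪ V₁ := (hL.trans (Finset.erase_subset _ _)).trans (hE.subset i hi)
        have hLcard : (L ∩ V₀).card + (L ∩ V₁).card ≠ 0 := by
          have := Finset.card_union_le (L ∩ V₀) (L ∩ V₁)
          rw [← Finset.inter_union_distrib_left, Finset.inter_eq_left.2 hLV] at this
          have := Finset.card_pos.2 hLne
          omega
        rw [Finset.insert_inter_of_mem hv,
          Finset.insert_inter_of_notMem (Finset.disjoint_right.1 hdisj hv),
          Finset.card_insert_of_notMem fun h => by simpa using hL (Finset.mem_inter.1 h).1,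
          codegreeWeight_add_one_right hLcard])
      (fun v hv => by
        rw [Finset.singleton_inter_of_mem hv,
          Finset.singleton_inter_of_notMem (Finset.disjoint_right.1 hdisj hv),
          Finset.card_singleton, Finset.card_empty, codegreeWeight_zero_one]
        have : (V₁.card : ℝ) ≠ 0 := by exact_mod_cast hn.ne'
        field_simp
        linarith)
      (fun i hi v hv hvi => by
        rw [Finset.erase_inter, Finset.erase_eq_of_notMem fun h =>
          Finset.disjoint_right.1 hdisj hv (Finset.mem_inter.1 h).2, hE.card_left i hi])
      (fun i hi v hv hvi => by
        rw [Finset.erase_inter, Finset.card_erase_of_mem (Finset.mem_inter.2 ⟨hvi, hv⟩),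
          hE.card_right i hi, Nat.succ_eq_add_one, Nat.add_sub_cancel])
      (fun W hW hWE => by
        refine ⟨V₁, subset_rfl, le_rfl, fun i hi => ?_⟩
        obtain ⟨v, hv⟩ := Finset.card_pos.1 (hs₁.trans_eq (hE.card_right i hi).symm)
        exact ⟨v, (Finset.mem_inter.1 hv).2, (Finset.mem_inter.1 hv).1⟩)
      (fun G p' hG => ih (by omega) (by positivity) hKδ' hG)
    refine ⟨t, fun W hW hWE => ?_⟩
    obtain ⟨S, X, S', X', hS, hX, hSV, hSb, hXV, h⟩ := ht W hW hWE
    have hSV₀ : S ∩ V₀ = ∅ := Finset.disjoint_iff_inter_eq_empty.1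
      (Finset.disjoint_of_subset_left hSV hdisj.symm)
    rw [hS, hX, Finset.union_inter_distrib_right, Finset.union_inter_distrib_right, hSV₀,
      Finset.inter_eq_left.2 hSV, Finset.empty_union]
    have hs₁' : s₁.succ * b = b + s₁ * b := by rw [Nat.succ_mul]; ring
    rcases h with ⟨rfl, hθ⟩ | ⟨h1, h2, h3, h4⟩
    · refine ⟨by simpa using hSV.trans Finset.subset_union_right, by simp,
        by rw [Finset.empty_inter, Finset.union_empty]; omega, Or.inr ⟨Nat.succ_ne_zero _, by simp, ?_⟩⟩
      refine hθ.trans ?_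
      gcongr
      exact Finset.subset_inter Finset.subset_union_left hXV
    · refine ⟨Finset.union_subset (hSV.trans Finset.subset_union_right) h1, h2,
        (Finset.card_union_le _ _).trans (by omega), ?_⟩
      refine h4.imp (fun h => h.trans ?_)
        (fun h => ⟨Nat.succ_ne_zero _, h.2.1, h.2.2.trans ?_⟩)
      all_goals
        gcongr
        exact Finset.subset_union_right

end Container

theorem sum_range_add_four_le (s : ℕ) : ∑ i ∈ Finset.range s, (i + 4) ≤ (s + 1) ^ 2 := by
  have h : (∑ i ∈ Finset.range s, (i + 4)) * 2 = s * (s + 7) := by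
    induction s with
    | zero => simp
    | succ s ih => rw [Finset.sum_range_succ, add_mul, ih]; ring
  rcases s with - | - | s
  · simp
  · simp
  · nlinarith

theorem exists_isSpreadFamily {α : Type*} [DecidableEq α] {r₀ r₁ : ℕ} {R : ℝ} (hR : 0 < R)
    {V₀ V₁ : Finset α} (hdisj : Disjoint V₀ V₁)
    {ℋ : Finset (Finset α × Finset α)} (hne : ℋ.Nonempty)
    (hbounded : ∀ e ∈ ℋ, e.1 ⊆ V₀ ∧ e.1.card ≤ r₀ ∧ e.2 ⊆ V₁ ∧ e.2.card ≤ r₁)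
    {b m q : ℕ} (hb : 0 < b) (hm : 0 < m) (hq : 0 < q) (hn : 0 < V₁.card)
    (hdeg : ∀ ℓ₀ ℓ₁ : ℕ, ℓ₀ ≤ r₀ → ℓ₁ ≤ r₁ → ℓ₀ + ℓ₁ ≠ 0 →
      ∀ L₀ L₁ : Finset α, L₀ ⊆ V₀ → L₁ ⊆ V₁ → L₀.card = ℓ₀ → L₁.card = ℓ₁ →
        ((ℋ.filter (fun e => L₀ ⊆ e.1 ∧ L₁ ⊆ e.2)).card : ℝ) ≤
          R * codegreeWeight b m q V₁.card ℓ₀ ℓ₁ * ℋ.card) :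
    ∃ s₀ ≤ r₀, ∃ s₁ ≤ r₁, ∃ E ⊆ ℋ, IsSpreadFamily V₀ V₁ b m q s₀ s₁ (R * 2 ^ (r₀ + r₁)) E
      fun e => e.1 ∪ e.2 := by
  have hunion₀ : ∀ e ∈ ℋ, (e.1 ∪ e.2) ∩ V₀ = e.1 := fun e he => by
    obtain ⟨h1, -, h2, -⟩ := hbounded e he
    rw [Finset.union_inter_distrib_right, Finset.inter_eq_left.2 h1,
      Finset.disjoint_iff_inter_eq_empty.1 (Finset.disjoint_of_subset_left h2 hdisj.symm),
      Finset.union_empty]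
  have hunion₁ : ∀ e ∈ ℋ, (e.1 ∪ e.2) ∩ V₁ = e.2 := fun e he => by
    obtain ⟨h1, -, h2, -⟩ := hbounded e he
    rw [Finset.union_inter_distrib_right, Finset.inter_eq_left.2 h2,
      Finset.disjoint_iff_inter_eq_empty.1 (Finset.disjoint_of_subset_left h1 hdisj),
      Finset.empty_union]
  have hcard : 0 < ℋ.card := Finset.card_pos.2 hne
  set T := Finset.range (r₀ + 1) ×ˢ Finset.range (r₁ + 1) with hT
  have hTcard : T.card ≤ 2 ^ (r₀ + r₁) := by
    rw [hT, Finset.card_product, Finset.card_range, Finset.card_range, pow_add]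
    exact Nat.mul_le_mul Nat.lt_two_pow_self Nat.lt_two_pow_self
  obtain ⟨⟨s₀, s₁⟩, hs, hfib⟩ := Finset.exists_lt_card_fiber_of_mul_lt_card_of_maps_to
    (s := ℋ) (t := T) (f := fun e => (e.1.card, e.2.card)) (n := (ℋ.card - 1) / T.card)
    (fun e he => by
      obtain ⟨-, h1, -, h2⟩ := hbounded e he
      simp only [hT, Finset.mem_product, Finset.mem_range]
      omega)
    (lt_of_le_of_lt (Nat.mul_div_le _ _) (by omega))
  set E := ℋ.filter fun e => (e.1.card, e.2.card) = (s₀, s₁) with hE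
  have hEcard : ℋ.card ≤ 2 ^ (r₀ + r₁) * E.card := by
    have hTpos : 0 < T.card := Finset.card_pos.2 ⟨_, hs⟩
    have h1 := (Nat.div_lt_iff_lt_mul hTpos).1 hfib
    have h2 : E.card * T.card ≤ E.card * 2 ^ (r₀ + r₁) := Nat.mul_le_mul_left _ hTcard
    rw [mul_comm (2 ^ _)]
    omega
  simp only [hT, Finset.mem_product, Finset.mem_range] at hs
  have hmemE : ∀ e ∈ E, e ∈ ℋ ∧ e.1.card = s₀ ∧ e.2.card = s₁ := fun e he => by
    simpa [hE] using he
  refine ⟨s₀, by omega, s₁, by omega, E, Finset.filter_subset _ _, ?_, ?_, ?_, ?_, ?_⟩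
  · rw [← Finset.card_pos]
    exact lt_of_le_of_lt (Nat.zero_le _) hfib
  · intro e he
    obtain ⟨h1, -, h2, -⟩ := hbounded e (hmemE e he).1
    exact Finset.union_subset_union h1 h2
  · intro e he
    rw [hunion₀ e (hmemE e he).1, (hmemE e he).2.1]
  · intro e he
    rw [hunion₁ e (hmemE e he).1, (hmemE e he).2.2]
  · intro L hL
    have hw := codegreeWeight_pos (b := b) (m := m) (q := q) (n := V₁.card)
      (by exact_mod_cast hb) (by exact_mod_cast hm) (by exact_mod_cast hq)
      (by exact_mod_cast hn) (L ∩ V₀).card (L ∩ V₁).card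
    rcases (E.filter fun e => L ⊆ e.1 ∪ e.2).eq_empty_or_nonempty with h0 | ⟨e, he⟩
    · rw [edgeDegree, h0, Finset.card_empty, Nat.cast_zero]
      positivity
    · rw [Finset.mem_filter] at he
      have heℋ := (hmemE e he.1).1
      obtain ⟨h1, h2, h3, h4⟩ := hbounded e heℋ
      have hL₀ : ∀ e ∈ ℋ, L ⊆ e.1 ∪ e.2 → L ∩ V₀ ⊆ e.1 := fun e he h => by
        rw [← hunion₀ e he]; exact Finset.inter_subset_inter_right h
      have hL₁ : ∀ e ∈ ℋ, L ⊆ e.1 ∪ e.2 → L ∩ V₁ ⊆ e.2 := fun e he h => by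
        rw [← hunion₁ e he]; exact Finset.inter_subset_inter_right h
      have hpos : (L ∩ V₀).card + (L ∩ V₁).card ≠ 0 := by
        have := Finset.card_union_le (L ∩ V₀) (L ∩ V₁)
        rw [← Finset.inter_union_distrib_left, Finset.inter_eq_left.2
          (he.2.trans (Finset.union_subset_union h1 h3))] at this
        have := Finset.card_pos.2 hL
        omega
      have hd := hdeg _ _ ((Finset.card_le_card (hL₀ e heℋ he.2)).trans h2)
        ((Finset.card_le_card (hL₁ e heℋ he.2)).trans h4) hpos _ _
        Finset.inter_subset_right Finset.inter_subset_right rfl rfl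
      have hle : (edgeDegree E (fun e => e.1 ∪ e.2) L : ℝ) ≤
          (ℋ.filter fun e => L ∩ V₀ ⊆ e.1 ∧ L ∩ V₁ ⊆ e.2).card := by
        refine Nat.cast_le.2 (Finset.card_le_card fun e he => ?_)
        rw [Finset.mem_filter] at he ⊢
        have := (hmemE e he.1).1
        exact ⟨this, hL₀ e this he.2, hL₁ e this he.2⟩
      have hEcard' : (ℋ.card : ℝ) ≤ 2 ^ (r₀ + r₁) * E.card := by exact_mod_cast hEcard
      refine hle.trans (hd.trans ?_)
      calc _ ≤ R * codegreeWeight b m q V₁.card (L ∩ V₀).card (L ∩ V₁).card *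
            (2 ^ (r₀ + r₁) * E.card) := by gcongr
        _ = _ := by ring

/-- (Asymmetric container lemma.) -/
theorem asymmetric_container_lemma {α : Type*} [DecidableEq α]
    (r₀ r₁ : ℕ) (hr : r₀ + r₁ ≠ 0) (R : ℝ) (hR : 0 < R)
    (V₀ V₁ : Finset α) (hdisj : Disjoint V₀ V₁)
    (ℋ : Finset (Finset α × Finset α)) (hne : ℋ.Nonempty)
    (hbounded : ∀ e ∈ ℋ, e.1 ⊆ V₀ ∧ e.1.card ≤ r₀ ∧ e.2 ⊆ V₁ ∧ e.2.card ≤ r₁)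
    (b m q : ℕ) (hb : 0 < b) (hm : 0 < m) (hq : 0 < q)
    (hbm : b ≤ m) (hbV : b ≤ V₁.card)
    (hdeg : ∀ ℓ₀ ℓ₁ : ℕ, ℓ₀ ≤ r₀ → ℓ₁ ≤ r₁ → ℓ₀ + ℓ₁ ≠ 0 →
      ∀ L₀ L₁ : Finset α, L₀ ⊆ V₀ → L₁ ⊆ V₁ → L₀.card = ℓ₀ → L₁.card = ℓ₁ →
        (((ℋ.filter (fun e => L₀ ⊆ e.1 ∧ L₁ ⊆ e.2)).card : ℝ) ≤
          R * ((b : ℝ) ^ (ℓ₀ + ℓ₁ - 1) / ((m : ℝ) ^ ℓ₀ * (V₁.card : ℝ) ^ ℓ₁)) *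
            (ℋ.card : ℝ) * ((m : ℝ) / (q : ℝ)) ^ (if 0 < ℓ₀ then 1 else 0))) :
    let δ : ℝ := (2 : ℝ) ^ (-(((r₀ + r₁ + 1) * (r₀ + r₁) : ℕ) : ℤ)) / R
    ∃ (𝒮 : Finset (Finset α × Finset α)) (f g : Finset α × Finset α → Finset α × Finset α),
      -- `𝒮 ⊆ binom(V₀, ≤ r₀b) × binom(V₁, ≤ r₁b)`
      (∀ S ∈ 𝒮, S.1 ⊆ V₀ ∧ S.1.card ≤ r₀ * b ∧ S.2 ⊆ V₁ ∧ S.2.card ≤ r₁ * b) ∧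
      -- `f` maps into `2^{V₀} × 2^{V₁}`
      (∀ S ∈ 𝒮, (f S).1 ⊆ V₀ ∧ (f S).2 ⊆ V₁) ∧
      -- property (ii): for every container `(A,B) = f S`
      (∀ S ∈ 𝒮, (δ * q ≤ ((f S).1.card : ℝ)) ∨ (((f S).2.card : ℝ) ≤ (1 - δ) * V₁.card)) ∧
      -- `g` maps `𝓕_{≤ m}(ℋ)` into `𝒮`, and properties (i) and (iii)
      (∀ I J : Finset α, I ⊆ V₀ → J ⊆ V₁ → I.card ≤ m →
        (∀ e ∈ ℋ, ¬(e.1 ⊆ V₀ \ I ∧ e.2 ⊆ J)) →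
        g (I, J) ∈ 𝒮 ∧
        (f (g (I, J))).1 ⊆ I ∧ J ⊆ (f (g (I, J))).2 ∧
        (g (I, J)).1 ⊆ V₀ \ I ∧ (g (I, J)).2 ⊆ J ∧
        ((g (I, J)).1.Nonempty → δ * q ≤ ((f (g (I, J))).1.card : ℝ))) := by
  intro δ
  classical
  have hn : 0 < V₁.card := hb.trans_le hbV
  have hδ : 0 < δ := by positivity
  obtain ⟨s₀, hs₀, s₁, hs₁, E, hEℋ, hE⟩ := exists_isSpreadFamily hR hdisj hne hbounded hb hm hq hn
    fun ℓ₀ ℓ₁ h0 h1 h L₀ L₁ hL₀ hL₁ hc₀ hc₁ =>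
      (hdeg ℓ₀ ℓ₁ h0 h1 h L₀ L₁ hL₀ hL₁ hc₀ hc₁).trans_eq (by rw [codegreeWeight]; ring)
  rcases Nat.eq_zero_or_pos (s₀ + s₁) with hs | hs
  · obtain ⟨e, he⟩ := hE.nonempty
    have hce := hE.card_eq hdisj he
    rw [hs, Finset.card_eq_zero] at hce
    refine ⟨∅, id, id, by simp, by simp, by simp, fun I J _ _ _ h => ?_⟩
    refine absurd ?_ (h e (hEℋ he))
    rw [Finset.union_eq_empty] at hce
    simp [hce.1, hce.2]
  obtain ⟨s, hs⟩ := Nat.exists_eq_succ_of_ne_zero hs.ne'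
  have hKδ : R * 2 ^ (r₀ + r₁) * δ * 2 ^ (∑ i ∈ Finset.range s, (i + 4)) ≤ 1 := by
    have hexp : r₀ + r₁ + ∑ i ∈ Finset.range s, (i + 4) ≤ (r₀ + r₁ + 1) * (r₀ + r₁) := by
      have h1 := sum_range_add_four_le s
      have h2 : (s + 1) ^ 2 ≤ (r₀ + r₁) ^ 2 := Nat.pow_le_pow_left (by omega) 2
      calc _ ≤ r₀ + r₁ + (r₀ + r₁) ^ 2 := by omega
        _ = _ := by ring
    have hδ' : δ = (2 ^ ((r₀ + r₁ + 1) * (r₀ + r₁)))⁻¹ / R := by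
      simp only [δ, zpow_neg, zpow_natCast]
    calc _ = (2 : ℝ) ^ (r₀ + r₁ + ∑ i ∈ Finset.range s, (i + 4)) /
          2 ^ ((r₀ + r₁ + 1) * (r₀ + r₁)) := by
          rw [hδ', pow_add _ (r₀ + r₁) (∑ i ∈ Finset.range s, (i + 4))]; field_simp
      _ ≤ 1 := by
          rw [div_le_one (by positivity)]
          exact pow_le_pow_right₀ (by norm_num) hexp
  obtain ⟨t, ht⟩ := hE.exists_isContainerTree hb hm hq hbm hbV hdisj hδ s hs (by positivity) hKδ
  let F : Finset (Finset α × Finset α) := (V₀.powerset ×ˢ V₁.powerset).filter fun P =>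
    P.1.card ≤ m ∧ ∀ e ∈ ℋ, ¬(e.1 ⊆ V₀ \ P.1 ∧ e.2 ⊆ P.2)
  let w : Finset α × Finset α → Finset α := fun P => (V₀ \ P.1) ∪ P.2
  let f : Finset α × Finset α → Finset α × Finset α := fun S =>
    (t.excluded (S.1 ∪ S.2) ∩ V₀, V₁ \ t.excluded (S.1 ∪ S.2))
  let g : Finset α × Finset α → Finset α × Finset α := fun P =>
    (t.fingerprint (w P) ∩ V₀, t.fingerprint (w P) ∩ V₁)
  have hF : ∀ P ∈ F, P.1 ⊆ V₀ ∧ P.2 ⊆ V₁ ∧ P.1.card ≤ m ∧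
      ∀ e ∈ ℋ, ¬(e.1 ⊆ V₀ \ P.1 ∧ e.2 ⊆ P.2) := fun P hP => by
    simpa [F, and_assoc] using hP
  have hw₀ : ∀ P ∈ F, w P ∩ V₀ = V₀ \ P.1 := fun P hP => by
    rw [Finset.union_inter_distrib_right, Finset.inter_eq_left.2 Finset.sdiff_subset,
      Finset.disjoint_iff_inter_eq_empty.1
        (Finset.disjoint_of_subset_left (hF P hP).2.1 hdisj.symm), Finset.union_empty]
  have hw₁ : ∀ P ∈ F, w P ∩ V₁ = P.2 := fun P hP => by
    rw [Finset.union_inter_distrib_right, Finset.inter_eq_left.2 (hF P hP).2.1,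
      Finset.disjoint_iff_inter_eq_empty.1
        (Finset.disjoint_of_subset_left Finset.sdiff_subset hdisj), Finset.empty_union]
  have hrun : ∀ P ∈ F, _ := fun P hP => ht (w P)
    (by
      refine (Finset.card_le_card fun v hv => ?_).trans (hF P hP).2.2.1
      simp only [w, Finset.mem_sdiff, Finset.mem_union, not_or, not_and, not_not] at hv
      exact hv.2.1 hv.1)
    (fun e he h => (hF P hP).2.2.2 e (hEℋ he) (by
      obtain ⟨h1, -, h2, -⟩ := hbounded e (hEℋ he)
      rw [← hw₀ P hP, ← hw₁ P hP]
      exact ⟨Finset.subset_inter (Finset.subset_union_left.trans h) h1,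
        Finset.subset_inter (Finset.subset_union_right.trans h) h2⟩))
  have hfg : ∀ P ∈ F, f (g P) = (t.excluded (w P) ∩ V₀, V₁ \ t.excluded (w P)) := fun P hP => by
    simp only [f, g, ← Finset.inter_union_distrib_left, Finset.inter_eq_left.2 (hrun P hP).1,
      t.excluded_fingerprint]
  refine ⟨F.image g, f, g, ?_, ?_, ?_, ?_⟩
  · intro S hS
    obtain ⟨P, hP, rfl⟩ := Finset.mem_image.1 hS
    obtain ⟨-, h0, h1, -⟩ := hrun P hP
    exact ⟨Finset.inter_subset_right, h0.trans (Nat.mul_le_mul_right b hs₀),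
      Finset.inter_subset_right, h1.trans (Nat.mul_le_mul_right b hs₁)⟩
  · exact fun S _ => ⟨Finset.inter_subset_right, Finset.sdiff_subset⟩
  · intro S hS
    obtain ⟨P, hP, rfl⟩ := Finset.mem_image.1 hS
    rw [hfg P hP]
    refine (hrun P hP).2.2.2.imp id fun h => ?_
    have hsplit := Finset.card_sdiff_add_card_inter V₁ (t.excluded (w P))
    rw [Finset.inter_comm] at hsplit
    have hsplit' : ((V₁ \ t.excluded (w P)).card : ℝ) + (t.excluded (w P) ∩ V₁).card = V₁.card := by
      exact_mod_cast hsplit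
    have := h.2.2
    linarith
  · intro I J hI hJ hIm hIJ
    have hP : (I, J) ∈ F := by simpa [F, hI, hJ, hIm] using hIJ
    have hdis := t.disjoint_excluded (w (I, J))
    have hfp := t.fingerprint_subset (w (I, J))
    have h₀ := hw₀ _ hP
    have h₁ := hw₁ _ hP
    refine ⟨Finset.mem_image_of_mem g hP, ?_⟩
    rw [hfg _ hP]
    refine ⟨fun v hv => ?_, fun v hv => ?_, ?_, ?_, fun hne => ?_⟩
    · rw [Finset.mem_inter] at hv
      by_contra hvI
      exact Finset.disjoint_left.1 hdis hv.1
        (Finset.mem_union_left _ (Finset.mem_sdiff.2 ⟨hv.2, hvI⟩))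
    · exact Finset.mem_sdiff.2
        ⟨hJ hv, Finset.disjoint_right.1 hdis (Finset.mem_union_right _ hv)⟩
    · exact (Finset.inter_subset_inter_right hfp).trans h₀.subset
    · exact (Finset.inter_subset_inter_right hfp).trans h₁.subset
    · exact (hrun _ hP).2.2.2.resolve_right fun h => hne.ne_empty h.2.1
end

section
/- Let l and t be positive integers with t ≤ l/40, and let B ⊆ ℤ be a finite set of size l. Suppose that ∑_{x ∈ ℤ} min(1_B*1_B(x), t) ≤ (2+δ)·l·t for some real 0 < δ ≤ 1/8. Then there is an arithmetic progression P of length at most (1+2δ)·l + 6t containing all but at most 3t points of B. -/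
open Pointwise

section PopularSums

open Finset

variable {G : Type*} [AddCommGroup G] [DecidableEq G]

/-- If `a`, `b` have many partners in `M` whose sum with them lies in a small set `P`,
then `a - b` has many representations as a difference of elements of `M`. -/
lemma card_partners_add_card_partners_le (M P : Finset G) (a b : G) :
    #{y ∈ M | a + y ∈ P} + #{y ∈ M | b + y ∈ P} ≤ #{x ∈ M | x + (a - b) ∈ M} + #P := by
  set X := {y ∈ M | a + y ∈ P}
  set Y := {y ∈ M | b + y ∈ P}
  have h1 : #(X.image (a + ·)) = #X := card_image_of_injective _ (add_right_injective a)
  have h2 : #(Y.image (b + ·)) = #Y := card_image_of_injective _ (add_right_injective b)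
  have h3 := card_union_add_card_inter (X.image (a + ·)) (Y.image (b + ·))
  have h4 : #(X.image (a + ·) ∪ Y.image (b + ·)) ≤ #P := by
    refine card_le_card ?_
    intro z hz
    simp only [X, Y, mem_union, mem_image, mem_filter] at hz
    rcases hz with ⟨y, hy, rfl⟩ | ⟨y, hy, rfl⟩
    exacts [hy.2, hy.2]
  have h5 : #(X.image (a + ·) ∩ Y.image (b + ·)) ≤ #{x ∈ M | x + (a - b) ∈ M} := by
    refine card_le_card_of_injOn (fun z => z - a) ?_ (sub_left_injective.injOn)
    intro z hz
    simp only [X, Y, coe_inter, coe_image, Set.mem_inter_iff, Set.mem_image, mem_coe,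
      mem_filter] at hz
    obtain ⟨⟨y, hy, rfl⟩, y', hy', h⟩ := hz
    simp only [coe_filter, Set.mem_ofPred_eq, add_sub_cancel_left]
    refine ⟨hy.1, ?_⟩
    rw [show y + (a - b) = (a + y) - b by abel, ← h]
    simpa using hy'.1
  omega

lemma card_filter_add_card_filter_not_mem (M P : Finset G) (a : G) :
    #{y ∈ M | a + y ∈ P} + #{y ∈ M | a + y ∉ P} = #M :=
  card_filter_add_card_filter_not _

/-- If `d` and `e` are both very popular differences of `M`, then `d + e` is a difference of two
elements of any sufficiently large subset `A` of `M`. -/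
lemma add_mem_sub_of_popular {M A : Finset G} {d e : G}
    (h : #M + 2 * #(M \ A) < #{x ∈ M | x + d ∈ M} + #{x ∈ M | x + -e ∈ M}) :
    d + e ∈ A - A := by
  set X := {x ∈ M | x + d ∈ M}
  set Y := {x ∈ M | x + -e ∈ M}
  have h1 := card_union_add_card_inter X Y
  have h2 : #(X ∪ Y) ≤ #M := card_le_card (union_subset (filter_subset _ _) (filter_subset _ _))
  set Z := (M \ A).image (· - d) ∪ (M \ A).image (· + e)
  have h3 : #Z ≤ #(M \ A) + #(M \ A) :=
    (card_union_le _ _).trans (add_le_add card_image_le card_image_le)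
  obtain ⟨x, hx, hxZ⟩ := exists_mem_notMem_of_card_lt_card (s := Z) (t := X ∩ Y) (by omega)
  simp only [X, Y, mem_inter, mem_filter] at hx
  simp only [Z, mem_union, mem_image, mem_sdiff, not_or, not_exists, not_and] at hxZ
  refine mem_sub.2 ⟨x + d, ?_, x + -e, ?_, by abel⟩
  · by_contra hA
    exact hxZ.1 _ ⟨hx.1.2, hA⟩ (by abel)
  · by_contra hA
    exact hxZ.2 _ ⟨hx.2.2, hA⟩ (by abel)

/-- If almost all pairs of elements of `M` have their sum in a set `P` not much larger than `M`,
and `P` contains all popular sums, then `M` is almost contained in a coset of a finite subgroup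
no larger than `P`. -/
lemma exists_coset_of_few_popular_sums (M P : Finset G) (l t : ℕ) (ht : 0 < t)
    (htl : 40 * t ≤ l) (hl : #M + 2 * t = l) (hP : 40 * #P ≤ 40 * #M + 9 * l)
    (hU : 40 * #{p ∈ M ×ˢ M | p.1 + p.2 ∉ P} ≤ 9 * l * t)
    (hpop : ∀ c, 2 * t ≤ #{p ∈ M ×ˢ M | p.1 + p.2 = c} → c ∈ P) :
    ∃ (H : AddSubgroup G) (T : Finset G) (a : G), (∀ x, x ∈ T ↔ x ∈ H) ∧ #T ≤ #P ∧
      ∃ E : Finset G, E ⊆ M ∧ #E ≤ t ∧ ∀ x ∈ M, x ∉ E → x - a ∈ H := by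
  have hlpos : 0 < l := by omega
  have hUsum : #{p ∈ M ×ˢ M | p.1 + p.2 ∉ P} = ∑ a ∈ M, #{y ∈ M | a + y ∉ P} := by
    simp only [card_filter, sum_product]
  rw [hUsum] at hU
  have markov : ∀ (E : Finset G) (c : ℕ), E ⊆ M → (∀ e ∈ E, c ≤ #{y ∈ M | e + y ∉ P}) →
      #E * c ≤ ∑ a ∈ M, #{y ∈ M | a + y ∉ P} := by
    intro E c hE h
    calc #E * c = ∑ e ∈ E, c := by simp
      _ ≤ ∑ e ∈ E, #{y ∈ M | e + y ∉ P} := sum_le_sum h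
      _ ≤ _ := sum_le_sum_of_subset hE
  set A := {a ∈ M | 20 * #{y ∈ M | a + y ∉ P} ≤ l} with hA
  have hAM : A ⊆ M := filter_subset _ _
  have hcard := card_sdiff_add_card_eq_card hAM
  have hq : 2 * #(M \ A) ≤ 9 * t := by
    have h := markov (M \ A) (l / 20 + 1) sdiff_subset fun e he => by
      simp only [hA, mem_sdiff, mem_filter, not_and, not_le] at he
      have := he.2 he.1
      omega
    have h' : #(M \ A) * l ≤ 20 * (#(M \ A) * (l / 20 + 1)) := by
      have : l ≤ 20 * (l / 20 + 1) := by omega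
      nlinarith
    refine Nat.le_of_mul_le_mul_right (c := l) ?_ hlpos
    nlinarith
  have hdiff : ∀ a ∈ A, ∀ b ∈ A, 40 * #M ≤ 40 * #{x ∈ M | x + (a - b) ∈ M} + 13 * l := by
    intro a ha b hb
    have h := card_partners_add_card_partners_le M P a b
    have h1 := card_filter_add_card_filter_not_mem M P a
    have h2 := card_filter_add_card_filter_not_mem M P b
    have h3 := (mem_filter.1 ha).2
    have h4 := (mem_filter.1 hb).2
    omega
  obtain ⟨a, ha⟩ : A.Nonempty := card_pos.1 (by omega)
  let H : AddSubgroup G :=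
    { carrier := ↑(A - A)
      zero_mem' := mem_coe.2 (mem_sub.2 ⟨a, ha, a, ha, sub_self a⟩)
      neg_mem' := by
        intro x hx
        obtain ⟨b, hb, c, hc, rfl⟩ := mem_sub.1 (mem_coe.1 hx)
        exact mem_coe.2 (mem_sub.2 ⟨c, hc, b, hb, by abel⟩)
      add_mem' := by
        intro x y hx hy
        obtain ⟨b, hb, c, hc, rfl⟩ := mem_sub.1 (mem_coe.1 hx)
        obtain ⟨b', hb', c', hc', rfl⟩ := mem_sub.1 (mem_coe.1 hy)
        refine mem_coe.2 (add_mem_sub_of_popular (M := M) ?_)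
        have h1 := hdiff b hb c hc
        have h2 := hdiff c' hc' b' hb'
        rw [neg_sub]
        omega }
  have hH : ∀ x, x ∈ A - A ↔ x ∈ H := fun x => mem_coe.symm
  have hHsmall : 2 * #(A - A) ≤ 3 * l := by
    have h : ∀ d ∈ A - A, 40 * #M ≤ 40 * #{x ∈ M | x + d ∈ M} + 13 * l := by
      intro d hd
      obtain ⟨b, hb, c, hc, rfl⟩ := mem_sub.1 hd
      exact hdiff b hb c hc
    have h1 : ∑ d ∈ A - A, #{x ∈ M | x + d ∈ M} ≤ #M * #M := by
      calc ∑ d ∈ A - A, #{x ∈ M | x + d ∈ M} = ∑ x ∈ M, #{d ∈ A - A | x + d ∈ M} := by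
            simp only [card_filter]; exact sum_comm
        _ ≤ ∑ x ∈ M, #M := by
            refine sum_le_sum fun x _ => ?_
            refine card_le_card_of_injOn (x + ·) ?_ (add_right_injective x).injOn
            intro d hd
            exact (mem_filter.1 (mem_coe.1 hd)).2
        _ = _ := by simp
    have h2 := sum_le_sum h
    simp only [sum_add_distrib, ← mul_sum, sum_const, smul_eq_mul] at h2
    by_contra! hcon
    have h3 : #(A - A) * (40 * #M) ≤ 40 * (#M * #M) + #(A - A) * (13 * l) := by
      nlinarith
    have hk : 20 * #M ≥ 19 * l := by omega
    have hk' : #M ≤ l := by omega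
    zify at *
    nlinarith
  have hcoset : ∀ x ∈ A, x - a ∈ H := fun x hx => (hH _).1 (mem_sub.2 ⟨x, hx, a, ha, rfl⟩)
  have hsub : (A - A).image (fun h => a + a + h) ⊆ P := by
    intro c hc
    obtain ⟨h, hh, rfl⟩ := mem_image.1 hc
    apply hpop
    have himg : #(A.image (fun x => a + a + h - x)) = #A :=
      card_image_of_injective _ sub_right_injective
    have hunion : #(A ∪ A.image (fun x => a + a + h - x)) ≤ #(A - A) := by
      refine card_le_card_of_injOn (fun x => x - a) ?_ (sub_left_injective.injOn)
      intro x hx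
      refine mem_coe.2 ((hH _).2 ?_)
      rcases mem_union.1 (mem_coe.1 hx) with hx | hx
      · exact hcoset x hx
      · obtain ⟨y, hy, rfl⟩ := mem_image.1 hx
        have := H.sub_mem ((hH _).1 hh) (hcoset y hy)
        rwa [show h - (y - a) = a + a + h - y - a by abel] at this
    have hinter := card_union_add_card_inter A (A.image (fun x => a + a + h - x))
    have hle : #(A ∩ A.image (fun x => a + a + h - x)) ≤
        #{p ∈ M ×ˢ M | p.1 + p.2 = a + a + h} := by
      refine card_le_card_of_injOn (fun x => (x, a + a + h - x)) ?_ ?_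
      · intro x hx
        obtain ⟨hx1, hx2⟩ := mem_inter.1 (mem_coe.1 hx)
        obtain ⟨y, hy, rfl⟩ := mem_image.1 hx2
        refine mem_coe.2 (mem_filter.2 ⟨mem_product.2 ⟨hAM hx1, ?_⟩, ?_⟩)
        · simpa using hAM hy
        · simp
      · intro x _ y _ hxy
        exact (Prod.ext_iff.1 hxy).1
    omega
  have himg : #((A - A).image (fun h => a + a + h)) = #(A - A) :=
    card_image_of_injective _ (add_right_injective _)
  have hAA : #A ≤ #(A - A) :=
    card_le_card_of_injOn (fun x => x - a)
      (fun x hx => mem_coe.2 ((hH _).2 (hcoset x (mem_coe.1 hx)))) sub_left_injective.injOn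
  classical
  refine ⟨H, A - A, a, hH, himg ▸ card_le_card hsub, {x ∈ M | x - a ∉ H}, filter_subset _ _, ?_,
    fun x hx hxE => by_contra fun hn => hxE (mem_filter.2 ⟨hx, hn⟩)⟩
  have hbad : ∀ e ∈ ({x ∈ M | x - a ∉ H} : Finset G),
      (l + 1) / 2 ≤ #{y ∈ M | e + y ∉ P} := by
    intro e he
    obtain ⟨heM, heH⟩ := mem_filter.1 he
    have hPs := card_sdiff_add_card_eq_card hsub
    have h1 : #{y ∈ A | e + y ∈ P} ≤ #(P \ (A - A).image (fun h => a + a + h)) := by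
      refine card_le_card_of_injOn (e + ·) ?_ (add_right_injective e).injOn
      intro y hy
      obtain ⟨hyA, hyP⟩ := mem_filter.1 (mem_coe.1 hy)
      refine mem_coe.2 (mem_sdiff.2 ⟨hyP, fun hmem => heH ?_⟩)
      obtain ⟨h, hh, heq⟩ := mem_image.1 hmem
      have := H.sub_mem ((hH _).1 hh) (hcoset y hyA)
      rwa [show h - (y - a) = (a + a + h) - y - a by abel, heq,
        show e + y - y - a = e - a by abel] at this
    have h2 := card_filter_add_card_filter_not_mem A P e
    have h3 : #{y ∈ A | e + y ∉ P} ≤ #{y ∈ M | e + y ∉ P} :=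
      card_le_card (filter_subset_filter _ hAM)
    omega
  have h := markov _ _ (filter_subset _ _) hbad
  set m := #{x ∈ M | x - a ∉ H}
  have h' : m * l ≤ 2 * (m * ((l + 1) / 2)) := by
    have : l ≤ 2 * ((l + 1) / 2) := by omega
    nlinarith
  refine Nat.le_of_mul_le_mul_right (c := l) ?_ hlpos
  nlinarith

end PopularSums

section Integers

open Finset

lemma exists_initial_segment {α : Type*} [LinearOrder α] (B : Finset α) (t : ℕ) (ht : t ≤ #B) :
    ∃ L ⊆ B, #L = t ∧ ∀ x ∈ L, ∀ y ∈ B \ L, x < y := by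
  induction t with
  | zero => exact ⟨∅, empty_subset _, rfl, by simp⟩
  | succ t ih =>
    obtain ⟨L, hL, hcard, hlt⟩ := ih (by omega)
    have hne : (B \ L).Nonempty := by
      rw [← card_pos, card_sdiff_of_subset hL]
      omega
    have hmin := mem_sdiff.1 (min'_mem _ hne)
    refine ⟨insert ((B \ L).min' hne) L, insert_subset hmin.1 hL, ?_, ?_⟩
    · rw [card_insert_of_notMem hmin.2, hcard]
    · intro x hx y hy
      simp only [mem_sdiff, mem_insert, not_or] at hy
      have hyL : y ∈ B \ L := mem_sdiff.2 ⟨hy.1, hy.2.2⟩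
      rcases mem_insert.1 hx with rfl | hx
      · exact lt_of_le_of_ne (min'_le _ _ hyL) (Ne.symm hy.2.1)
      · exact hlt x hx y hyL

/-- Some translate of `M` by an element of `L` contains at least the average number of points
of `Q`. -/
lemma exists_sum_card_le_mul_card (L M Q : Finset ℤ) (hL : L.Nonempty) :
    ∃ u ∈ L, ∑ x ∈ Q, #{y ∈ L | x - y ∈ M} ≤ #L * #{x ∈ Q | x - u ∈ M} := by
  have h : ∑ x ∈ Q, #{y ∈ L | x - y ∈ M} = ∑ y ∈ L, #{x ∈ Q | x - y ∈ M} := by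
    simp only [card_filter]
    exact sum_comm
  obtain ⟨u, hu, hmax⟩ := exists_max_image L (fun y => #{x ∈ Q | x - y ∈ M}) hL
  refine ⟨u, hu, ?_⟩
  rw [h, ← smul_eq_mul]
  exact sum_le_card_nsmul _ _ _ hmax

lemma sum_card_filter_sub_mem {L M B : Finset ℤ} (hL : L ⊆ B) (hM : M ⊆ B) :
    ∑ x ∈ B + B, #{y ∈ L | x - y ∈ M} = #L * #M := by
  calc ∑ x ∈ B + B, #{y ∈ L | x - y ∈ M} = ∑ y ∈ L, #{x ∈ B + B | x - y ∈ M} := by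
        simp only [card_filter]
        exact sum_comm
    _ = ∑ y ∈ L, #M := by
        refine sum_congr rfl fun y hy => ?_
        rw [← card_image_of_injective M (add_right_injective y)]
        congr 1
        ext x
        simp only [mem_filter, mem_image]
        constructor
        · exact fun h => ⟨x - y, h.2, by simp⟩
        · rintro ⟨m, hm, rfl⟩
          exact ⟨add_mem_add (hL hy) (hM hm), by simpa using hm⟩
    _ = _ := by simp

/-- A lower bound for the truncated sum of representation counts, from sums of the blocks `L` and
`R` with `M` and sums of `M` with itself. -/
lemma popular_add_unpopular_le_sum_min {B L M R : Finset ℤ} (t : ℕ)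
    (hL : L ⊆ B) (hM : M ⊆ B) (hR : R ⊆ B) (hLM : Disjoint L M) (hLR : Disjoint L R)
    (hMR : Disjoint M R) {Q : Finset ℤ}
    (hQ : Q = {x ∈ B + B | t ≤ #{p ∈ B ×ˢ B | p.1 + p.2 = x}}) :
    #Q * t + (#L * #M + #R * #M) + #{p ∈ M ×ˢ M | p.1 + p.2 ∉ Q} ≤
      ∑ x ∈ B + B, min #{p ∈ B ×ˢ B | p.1 + p.2 = x} t +
        (∑ x ∈ Q, #{y ∈ L | x - y ∈ M} + ∑ x ∈ Q, #{y ∈ R | x - y ∈ M}) := by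
  have hQsub : Q ⊆ B + B := hQ ▸ filter_subset _ _
  have hpair : #{p ∈ M ×ˢ M | p.1 + p.2 ∉ Q} =
      ∑ x ∈ (B + B) \ Q, #{p ∈ M ×ˢ M | p.1 + p.2 = x} := by
    rw [card_eq_sum_card_fiberwise (f := fun p : ℤ × ℤ => p.1 + p.2) (t := (B + B) \ Q)]
    · refine sum_congr rfl fun x hx => ?_
      rw [filter_filter]
      congr 1
      refine filter_congr fun p _ => ?_
      constructor
      · exact fun h => h.2
      · rintro rfl
        exact ⟨(mem_sdiff.1 hx).2, rfl⟩
    · intro p hp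
      obtain ⟨hp1, hp2⟩ := mem_filter.1 (mem_coe.1 hp)
      obtain ⟨hp3, hp4⟩ := mem_product.1 hp1
      exact mem_coe.2 (mem_sdiff.2 ⟨add_mem_add (hM hp3) (hM hp4), hp2⟩)
  have hcount : ∀ x, #{y ∈ L | x - y ∈ M} + #{y ∈ R | x - y ∈ M} +
      #{p ∈ M ×ˢ M | p.1 + p.2 = x} ≤ #{p ∈ B ×ˢ B | p.1 + p.2 = x} := by
    intro x
    have hconv : #{p ∈ M ×ˢ M | p.1 + p.2 = x} ≤ #{y ∈ M | x - y ∈ M} := by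
      refine card_le_card_of_injOn Prod.fst ?_ ?_
      · rintro ⟨p, q⟩ hp
        simp only [coe_filter, mem_product, Set.mem_ofPred_eq] at hp ⊢
        refine ⟨hp.1.1, ?_⟩
        rw [← hp.2]
        simpa using hp.1.2
      · rintro ⟨p, q⟩ hp ⟨p', q'⟩ hp' h
        simp only [coe_filter, mem_product, Set.mem_ofPred_eq] at hp hp' h
        ext <;> simp <;> omega
    have hunion : #(({y ∈ L | x - y ∈ M} ∪ {y ∈ R | x - y ∈ M}) ∪ {y ∈ M | x - y ∈ M}) ≤
        #{p ∈ B ×ˢ B | p.1 + p.2 = x} := by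
      refine card_le_card_of_injOn (fun y => (y, x - y)) ?_ ?_
      · intro y hy
        simp only [coe_union, coe_filter, Set.mem_union, Set.mem_ofPred_eq, mem_product] at hy ⊢
        refine ⟨⟨?_, ?_⟩, by ring⟩
        · rcases hy with (hy | hy) | hy
          exacts [hL hy.1, hR hy.1, hM hy.1]
        · rcases hy with (hy | hy) | hy <;> exact hM hy.2
      · intro y _ y' _ h
        exact (Prod.ext_iff.1 h).1
    rw [card_union_of_disjoint, card_union_of_disjoint] at hunion
    · omega
    · exact disjoint_filter_filter hLR
    · exact disjoint_union_left.2
        ⟨disjoint_filter_filter hLM, disjoint_filter_filter hMR.symm⟩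
  have hQt : ∑ x ∈ Q, min #{p ∈ B ×ˢ B | p.1 + p.2 = x} t = #Q * t := by
    rw [← smul_eq_mul, ← sum_const]
    refine sum_congr rfl fun x hx => min_eq_right ?_
    rw [hQ] at hx
    exact (mem_filter.1 hx).2
  have hrest : ∑ x ∈ (B + B) \ Q, (#{y ∈ L | x - y ∈ M} + #{y ∈ R | x - y ∈ M} +
      #{p ∈ M ×ˢ M | p.1 + p.2 = x}) ≤
        ∑ x ∈ (B + B) \ Q, min #{p ∈ B ×ˢ B | p.1 + p.2 = x} t := by
    refine sum_le_sum fun x hx => le_min (hcount x) ((hcount x).trans ?_)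
    simp only [hQ, mem_sdiff, mem_filter, not_and, not_le] at hx
    exact (hx.2 hx.1).le
  rw [sum_add_distrib, sum_add_distrib, ← hpair] at hrest
  have h1 := sum_sdiff (f := fun x => min #{p ∈ B ×ˢ B | p.1 + p.2 = x} t) hQsub
  have h2 := sum_sdiff (f := fun x => #{y ∈ L | x - y ∈ M}) hQsub
  have h3 := sum_sdiff (f := fun x => #{y ∈ R | x - y ∈ M}) hQsub
  rw [sum_card_filter_sub_mem hL hM] at h2
  rw [sum_card_filter_sub_mem hR hM] at h3
  omega

/-- A subgroup of `ZMod n` consists of multiples of some `d` with `n / d` at most its order. -/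
lemma exists_dvd_of_mem_subgroup_zmod (n : ℕ) (hn : 0 < n) (H : AddSubgroup (ZMod n))
    (T : Finset (ZMod n)) (hT : ∀ x, x ∈ T ↔ x ∈ H) :
    ∃ d : ℕ, 0 < d ∧ n ≤ d * #T ∧ ∀ z : ℤ, (z : ZMod n) ∈ H → (d : ℤ) ∣ z := by
  obtain ⟨g, hg⟩ := Int.subgroup_cyclic (H.comap (Int.castAddHom (ZMod n)))
  rw [← AddSubgroup.zmultiples_eq_closure] at hg
  have hmem : ∀ z : ℤ, (z : ZMod n) ∈ H ↔ g ∣ z := by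
    intro z
    rw [← Int.mem_zmultiples_iff, ← hg]
    rfl
  have hgn : g.natAbs ∣ n := by
    rw [← Int.natAbs_natCast n, Int.natAbs_dvd_natAbs, ← hmem]
    simp
  obtain ⟨q, hq⟩ := hgn
  have hd : 0 < g.natAbs := Nat.pos_of_ne_zero fun h => by simp [h] at hq; omega
  refine ⟨g.natAbs, hd, ?_, fun z hz => by simpa using (hmem z).1 hz⟩
  have hle : #(range q) ≤ #T := by
    refine card_le_card_of_injOn (fun i => ((g.natAbs * i : ℕ) : ZMod n)) ?_ ?_
    · intro i _
      refine mem_coe.2 ((hT _).2 ?_)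
      have := (hmem ((g.natAbs * i : ℕ) : ℤ)).2 (by
        push_cast
        exact Dvd.dvd.mul_right (by simp) _)
      simpa using this
    · intro i hi j hj hij
      have hi' : g.natAbs * i < n := by
        rw [hq]; exact Nat.mul_lt_mul_of_pos_left (mem_range.1 (mem_coe.1 hi)) hd
      have hj' : g.natAbs * j < n := by
        rw [hq]; exact Nat.mul_lt_mul_of_pos_left (mem_range.1 (mem_coe.1 hj)) hd
      have := (ZMod.natCast_eq_natCast_iff' _ _ _).1 hij
      rw [Nat.mod_eq_of_lt hi', Nat.mod_eq_of_lt hj'] at this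
      exact Nat.eq_of_mul_eq_mul_left hd this
  rw [card_range] at hle
  calc n = g.natAbs * q := hq
    _ ≤ _ := Nat.mul_le_mul_left _ hle

/-- If the sums of `M ⊆ (u, v)` with itself lying in `B + B` are popular for most pairs, and most
popular sums lie in `(u + M) ∪ (v + M)`, then `M` is almost contained in a short progression. -/
lemma exists_progression_of_popular (B M Q : Finset ℤ) (l t : ℕ) (u v : ℤ) (ht : 0 < t)
    (htl : 40 * t ≤ l) (hl : #M + 2 * t = l) (hMB : M ⊆ B) (hu : ∀ x ∈ M, u < x)
    (hv : ∀ x ∈ M, x < v) (hQ : Q = {x ∈ B + B | t ≤ #{p ∈ B ×ˢ B | p.1 + p.2 = x}})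
    (hF : 40 * #Q ≤ 40 * (#{x ∈ Q | x - u ∈ M} + #{x ∈ Q | x - v ∈ M}) + 9 * l)
    (hU : 40 * #{p ∈ M ×ˢ M | p.1 + p.2 ∉ Q} ≤ 9 * l * t) :
    ∃ (a : ℤ) (d L : ℕ), 0 < d ∧
      L + (#{x ∈ Q | x - u ∈ M} + #{x ∈ Q | x - v ∈ M}) ≤ #M + #Q ∧
      #{x ∈ M | x ∉ (range L).image (fun i : ℕ => a + (i : ℤ) * d)} ≤ t := by
  obtain ⟨m, hm⟩ : M.Nonempty := card_pos.1 (by omega)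
  have huv : u < v := (hu m hm).trans (hv m hm)
  obtain ⟨n, hn⟩ := Int.eq_ofNat_of_zero_le (sub_nonneg.2 huv.le)
  have hnpos : 0 < n := by omega
  set φ : ℤ → ZMod n := fun x => (x : ZMod n) with hφ
  have hφeq : ∀ x y : ℤ, φ x = φ y → |y - x| < n → x = y := by
    intro x y h hlt
    have h1 := (ZMod.intCast_eq_intCast_iff_dvd_sub x y n).1 h
    have := Int.eq_zero_of_abs_lt_dvd h1 hlt
    omega
  have hinj : Set.InjOn φ M := by
    intro x hx y hy h
    refine hφeq x y h (abs_lt.2 ?_)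
    have := hu x hx
    have := hu y hy
    have := hv x hx
    have := hv y hy
    omega
  have hcardM : #(M.image φ) = #M := card_image_of_injOn hinj
  set X := {x ∈ Q | x - u ∈ M}
  set Y := {x ∈ Q | x - v ∈ M}
  have hXY : Disjoint X Y := by
    refine disjoint_filter.2 fun x _ h1 h2 => ?_
    have := hv _ h1
    have := hu _ h2
    omega
  have hXYQ : X ∪ Y ⊆ Q := union_subset (filter_subset _ _) (filter_subset _ _)
  have hXYcard : #(X ∪ Y) = #X + #Y := card_union_of_disjoint hXY
  have hvu : φ v = φ u := by
    refine ((ZMod.intCast_eq_intCast_iff_dvd_sub u v n).2 ?_).symm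
    rw [hn]
  have himgXY : #((X ∪ Y).image φ) ≤ #M := by
    rw [← hcardM, ← card_image_of_injective (M.image φ) (add_right_injective (φ u))]
    refine card_le_card fun c hc => ?_
    obtain ⟨x, hx, rfl⟩ := mem_image.1 hc
    rcases mem_union.1 hx with hx | hx
    · refine mem_image.2 ⟨φ (x - u), mem_image_of_mem _ (mem_filter.1 hx).2, ?_⟩
      simp [hφ]
    · refine mem_image.2 ⟨φ (x - v), mem_image_of_mem _ (mem_filter.1 hx).2, ?_⟩
      rw [← hvu]
      simp [hφ]
  have hP : #(Q.image φ) + (#X + #Y) ≤ #M + #Q := by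
    have h1 : #(Q.image φ) ≤ #((X ∪ Y).image φ) + #((Q \ (X ∪ Y)).image φ) := by
      rw [← union_sdiff_of_subset hXYQ, image_union]
      refine (card_union_le _ _).trans ?_
      rw [union_sdiff_of_subset hXYQ]
    have h2 : #((Q \ (X ∪ Y)).image φ) ≤ #(Q \ (X ∪ Y)) := card_image_le
    have h3 := card_sdiff_add_card_eq_card hXYQ
    omega
  have hbad : #{p ∈ M.image φ ×ˢ M.image φ | p.1 + p.2 ∉ Q.image φ} ≤
      #{p ∈ M ×ˢ M | p.1 + p.2 ∉ Q} := by
    refine le_trans (card_le_card ?_) (card_image_le (f := Prod.map φ φ))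
    rintro ⟨p, q⟩ hpq
    simp only [mem_filter, mem_product] at hpq
    obtain ⟨⟨hp, hq⟩, hpq⟩ := hpq
    obtain ⟨x, hx, rfl⟩ := mem_image.1 hp
    obtain ⟨y, hy, rfl⟩ := mem_image.1 hq
    refine mem_image.2 ⟨(x, y), mem_filter.2 ⟨mem_product.2 ⟨hx, hy⟩, fun h => hpq ?_⟩, rfl⟩
    refine mem_image.2 ⟨x + y, h, ?_⟩
    simp [hφ]
  have hpop : ∀ c, 2 * t ≤ #{p ∈ M.image φ ×ˢ M.image φ | p.1 + p.2 = c} → c ∈ Q.image φ := by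
    intro c hc
    by_contra hcQ
    have hle : #{p ∈ M.image φ ×ˢ M.image φ | p.1 + p.2 = c} ≤
        #{p ∈ M ×ˢ M | φ (p.1 + p.2) = c} := by
      refine le_trans (card_le_card ?_) (card_image_le (f := Prod.map φ φ))
      rintro ⟨p, q⟩ hpq
      simp only [mem_filter, mem_product] at hpq
      obtain ⟨⟨hp, hq⟩, hpq⟩ := hpq
      obtain ⟨x, hx, rfl⟩ := mem_image.1 hp
      obtain ⟨y, hy, rfl⟩ := mem_image.1 hq
      refine mem_image.2 ⟨(x, y), mem_filter.2 ⟨mem_product.2 ⟨hx, hy⟩, ?_⟩, rfl⟩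
      rw [← hpq]
      simp [hφ]
    have hfew : ∀ S ⊆ ({p ∈ M ×ˢ M | φ (p.1 + p.2) = c} : Finset (ℤ × ℤ)),
        (∀ p ∈ S, ∀ q ∈ S, |(q.1 + q.2) - (p.1 + p.2)| < n) → #S < t := by
      intro S hS hclose
      rcases S.eq_empty_or_nonempty with rfl | ⟨p, hp⟩
      · simpa using ht
      have hp' := mem_filter.1 (hS hp)
      have hpM := mem_product.1 hp'.1
      have hpQ : p.1 + p.2 ∉ Q := fun h => hcQ (mem_image.2 ⟨_, h, hp'.2⟩)
      rw [hQ, mem_filter, not_and, not_le] at hpQ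
      refine lt_of_le_of_lt (card_le_card fun q hq => ?_)
        (hpQ (add_mem_add (hMB hpM.1) (hMB hpM.2)))
      have hq' := mem_filter.1 (hS hq)
      have hqM := mem_product.1 hq'.1
      refine mem_filter.2 ⟨mem_product.2 ⟨hMB hqM.1, hMB hqM.2⟩, ?_⟩
      exact (hφeq _ _ (hp'.2.trans hq'.2.symm) (hclose p hp q hq)).symm
    have hrange : ∀ p ∈ ({p ∈ M ×ˢ M | φ (p.1 + p.2) = c} : Finset (ℤ × ℤ)),
        2 * u < p.1 + p.2 ∧ p.1 + p.2 < 2 * v := by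
      intro p hp
      have hpM := mem_product.1 (mem_filter.1 hp).1
      have := hu _ hpM.1
      have := hu _ hpM.2
      have := hv _ hpM.1
      have := hv _ hpM.2
      omega
    have hsplit := card_filter_add_card_filter_not (s := {p ∈ M ×ˢ M | φ (p.1 + p.2) = c})
      (fun p : ℤ × ℤ => p.1 + p.2 < u + v)
    have h1 := hfew _ (filter_subset (fun p : ℤ × ℤ => p.1 + p.2 < u + v) _) (by
      intro p hp q hq
      have := hrange p (mem_filter.1 hp).1
      have := hrange q (mem_filter.1 hq).1
      have := (mem_filter.1 hp).2
      have := (mem_filter.1 hq).2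
      exact abs_lt.2 (by omega))
    have h2 := hfew _ (filter_subset (fun p : ℤ × ℤ => ¬ p.1 + p.2 < u + v) _) (by
      intro p hp q hq
      have := hrange p (mem_filter.1 hp).1
      have := hrange q (mem_filter.1 hq).1
      have := (mem_filter.1 hp).2
      have := (mem_filter.1 hq).2
      exact abs_lt.2 (by omega))
    omega
  obtain ⟨H, T, a, hT, hTP, E, hEM, hEt, hE⟩ :=
    exists_coset_of_few_popular_sums (M.image φ) (Q.image φ) l t ht htl (by omega) (by omega)
      (by omega) hpop
  obtain ⟨d, hd, hnd, hdvd⟩ := exists_dvd_of_mem_subgroup_zmod n hnpos H T hT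
  obtain ⟨z, rfl⟩ := ZMod.intCast_surjective a
  refine ⟨u + 1 + (z - (u + 1)) % d, d, #T, hd, by omega, ?_⟩
  refine le_trans ?_ hEt
  refine card_le_card_of_injOn φ ?_ (hinj.mono ?_)
  · intro x hx
    obtain ⟨hxM, hxA⟩ := mem_filter.1 (mem_coe.1 hx)
    by_contra hxE
    refine hxA ?_
    have hmem := hE (φ x) (mem_image_of_mem _ hxM) hxE
    have hdx : (d : ℤ) ∣ x - z := hdvd _ (by simpa [hφ] using hmem)
    have hdpos : (0 : ℤ) < d := by exact_mod_cast hd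
    have hux := hu x hxM
    have hvx := hv x hxM
    have hmod : (z - (u + 1)) % d = (x - (u + 1)) % d := by
      refine Int.ModEq.eq (Int.modEq_iff_dvd.2 ?_)
      rwa [show x - (u + 1) - (z - (u + 1)) = x - z by ring]
    rw [hmod]
    have hdecomp := Int.emod_add_mul_ediv (x - (u + 1)) d
    have hq0 : 0 ≤ (x - (u + 1)) / d := Int.ediv_nonneg (by omega) hdpos.le
    have hr0 := Int.emod_nonneg (x - (u + 1)) hdpos.ne'
    have hnd' : (n : ℤ) ≤ d * #T := by exact_mod_cast hnd
    have hqT : (x - (u + 1)) / d < #T := by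
      refine lt_of_mul_lt_mul_left (a := (d : ℤ)) ?_ hdpos.le
      omega
    refine mem_image.2 ⟨((x - (u + 1)) / d).toNat, mem_range.2 (by omega), ?_⟩
    rw [Int.toNat_of_nonneg hq0]
    linarith
  · exact fun x hx => (mem_filter.1 (mem_coe.1 hx)).1

end Integers

/-- (Mazur's stability theorem.) Let `l, t ≥ 1` with `t ≤ l/40`, and
let `B ⊆ ℤ` have size `l`. If `∑_{x ∈ ℤ} min(1_B*1_B(x), t) ≤ (2+δ)lt` for some
`0 < δ ≤ 1/8`, then there is an arithmetic progression of length at most `(1+2δ)l + 6t`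
containing all but at most `3t` points of `B`. -/
theorem mazur_stability
    (l t : ℕ) (hl : 0 < l) (ht : 0 < t) (htl : (t : ℝ) ≤ (l : ℝ) / 40)
    (B : Finset ℤ) (hB : B.card = l)
    (δ : ℝ) (hδ0 : 0 < δ) (hδ : δ ≤ 1 / 8)
    (hsum : ((∑ x ∈ B + B,
        min (((B ×ˢ B).filter (fun p => p.1 + p.2 = x)).card) t : ℕ) : ℝ) ≤
      (2 + δ) * l * t) :
    ∃ a d : ℤ, d ≠ 0 ∧ ∃ L : ℕ, ((L : ℝ) ≤ (1 + 2 * δ) * l + 6 * t) ∧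
      (B \ (Finset.range L).image (fun i : ℕ => a + (i : ℤ) * d)).card ≤ 3 * t := by
  classical
  subst hB
  have htl' : 40 * t ≤ B.card := by
    have : (40 * t : ℝ) ≤ B.card := by linarith
    exact_mod_cast this
  obtain ⟨L, hLB, hLt, hLlt⟩ := exists_initial_segment B t (by omega)
  have hBL := Finset.card_sdiff_add_card_eq_card hLB
  obtain ⟨R, hRB, hRt, hRlt⟩ := exists_initial_segment (α := ℤᵒᵈ) (B \ L) t (by
    change t ≤ (B \ L).card
    omega)
  change Finset ℤ at R
  change R ⊆ B \ L at hRB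
  change R.card = t at hRt
  change ∀ x ∈ R, ∀ y ∈ (B \ L) \ R, y < x at hRlt
  have hBR := Finset.card_sdiff_add_card_eq_card hRB
  set M := (B \ L) \ R with hM
  have hMBL : M ⊆ B \ L := Finset.sdiff_subset
  have hMB : M ⊆ B := hMBL.trans Finset.sdiff_subset
  have hRB' : R ⊆ B := hRB.trans Finset.sdiff_subset
  have hl' : M.card + 2 * t = B.card := by omega
  set Q := (B + B).filter (fun x => t ≤ ((B ×ˢ B).filter (fun p => p.1 + p.2 = x)).card) with hQ
  have hmain := popular_add_unpopular_le_sum_min t hLB hMB hRB'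
    (Finset.disjoint_of_subset_right hMBL Finset.disjoint_sdiff)
    (Finset.disjoint_of_subset_right hRB Finset.disjoint_sdiff) Finset.sdiff_disjoint hQ
  obtain ⟨u, hu, hu'⟩ := exists_sum_card_le_mul_card L M Q (Finset.card_pos.1 (by omega))
  obtain ⟨v, hv, hv'⟩ := exists_sum_card_le_mul_card R M Q (Finset.card_pos.1 (by omega))
  rw [hLt] at hmain hu'
  rw [hRt] at hmain hv'
  set CL := (Q.filter (fun x => x - u ∈ M)).card with hCL
  set CR := (Q.filter (fun x => x - v ∈ M)).card with hCR
  set U := ((M ×ˢ M).filter (fun p => p.1 + p.2 ∉ Q)).card with hU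
  set S := ∑ x ∈ B + B, min (((B ×ˢ B).filter (fun p => p.1 + p.2 = x)).card) t with hS
  have hkey : (Q.card * t + 2 * t * M.card + U : ℝ) ≤ (2 + δ) * B.card * t + t * (CL + CR) := by
    have h : Q.card * t + 2 * t * M.card + U ≤ S + t * (CL + CR) := by linarith
    have h' : (Q.card * t + 2 * t * M.card + U : ℝ) ≤ S + t * (CL + CR) := by exact_mod_cast h
    linarith
  have htpos : (0 : ℝ) < t := by exact_mod_cast ht
  have hlR : (M.card : ℝ) + 2 * t = B.card := by exact_mod_cast hl'
  have hkey2 : ((Q.card - CL - CR : ℝ) * t + U) ≤ (δ * B.card + 4 * t) * t := by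
    rw [← hlR] at hkey ⊢
    linarith
  have hbound : δ * B.card + 4 * t ≤ 9 / 40 * (B.card : ℝ) := by
    have : δ * B.card ≤ 1 / 8 * (B.card : ℝ) := by gcongr
    linarith
  have hXY : CL + CR ≤ Q.card := by
    rw [hCL, hCR, ← Finset.card_union_of_disjoint]
    · exact Finset.card_le_card
        (Finset.union_subset (Finset.filter_subset _ _) (Finset.filter_subset _ _))
    · refine Finset.disjoint_filter.2 fun x _ h1 h2 => ?_
      have := hRlt v hv _ h1
      have := hLlt u hu _ (hMBL h2)
      omega
  have hXY' : (CL + CR : ℝ) ≤ Q.card := by exact_mod_cast hXY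
  have hFreal : (Q.card - CL - CR : ℝ) ≤ δ * B.card + 4 * t := by
    refine le_of_mul_le_mul_right (le_trans ?_ hkey2) htpos
    have : (0 : ℝ) ≤ U := Nat.cast_nonneg _
    linarith
  have hF : 40 * Q.card ≤ 40 * (CL + CR) + 9 * B.card := by
    have : (40 * Q.card : ℝ) ≤ 40 * (CL + CR) + 9 * B.card := by linarith
    exact_mod_cast this
  have hU' : 40 * U ≤ 9 * B.card * t := by
    have h1 : (δ * B.card + 4 * t) * t ≤ 9 / 40 * (B.card : ℝ) * t := by gcongr
    have h2 : 0 ≤ (Q.card - CL - CR : ℝ) * t := mul_nonneg (by linarith) htpos.le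
    have : (40 * U : ℝ) ≤ 9 * B.card * t := by linarith
    exact_mod_cast this
  obtain ⟨a, d, N, hd, hN, hE⟩ := exists_progression_of_popular B M Q B.card t u v ht htl' hl' hMB
    (fun x hx => hLlt u hu x (hMBL hx)) (fun x hx => hRlt v hv x hx) hQ hF hU'
  refine ⟨a, d, by exact_mod_cast hd.ne', N, ?_, ?_⟩
  · have hN' : (N + (CL + CR) : ℝ) ≤ M.card + Q.card := by exact_mod_cast hN
    have : 0 ≤ δ * B.card := by positivity
    linarith
  · set A := (Finset.range N).image (fun i : ℕ => a + (i : ℤ) * d)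
    have hsub : B \ A ⊆ (L ∪ R) ∪ M.filter (fun x => x ∉ A) := by
      intro x hx
      simp only [hM, Finset.mem_sdiff, Finset.mem_union, Finset.mem_filter] at hx ⊢
      tauto
    have h1 := Finset.card_le_card hsub
    have h2 := Finset.card_union_le (L ∪ R) (M.filter (fun x => x ∉ A))
    have h3 := Finset.card_union_le L R
    omega
end
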